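/- arXiv:0910.1036 — 7 statements merged into one kernel-verified Lean document; each statement's English description precedes it below -/
import Mathlib

section
/- Let f : U → ℂ be a holomorphic function on an open set U ⊆ ℂ, and let ι_ℂ : ℂ → 𝔹 be the embedding ι_ℂ(x + yi) = x + yi₂ = (x,y) ∈ ℂ² for x, y ∈ ℝ. Then: (1) there exist an open set Ũ ⊆ ℂ² with Ũ ∩ ι_ℂ(ℂ) = ι_ℂ(U) and a bicomplex-holomorphic map ψ : Ũ → 𝔹 with ψ(ι_ℂ(z)) = ι_ℂ(f(z)) for all z ∈ U; (2) the germ of such an extension along ι_ℂ(U) is unique: any two such extensions agree on some open set containing ι_ℂ(U); (3) conversely, if ψ : Ũ → 𝔹 is bicomplex-holomorphic on an open Ũ ⊆ ℂ² and U := {z ∈ ℂ : ι_ℂ(z) ∈ Ũ} is nonempty, then the restriction F : U → 𝔹, F(x + yi) := ψ(x, y), is holomorphic with respect to i₂, i.e. it satisfies ∂F/∂y = i₂·∂F/∂x on U. -/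
noncomputable section

/-- Bicomplex multiplication on `𝔹 = ℂ × ℂ`. -/
def bmul (q w : ℂ × ℂ) : ℂ × ℂ := (q.1 * w.1 - q.2 * w.2, q.1 * w.2 + q.2 * w.1)

/-- The embedding `ι_ℂ : ℂ → 𝔹`, `x + y i ↦ x + y i₂ = (x, y)`. -/
def iotaC (z : ℂ) : ℂ × ℂ := ((z.re : ℂ), (z.im : ℂ))

/-- Bicomplex-holomorphic map on an open subset of `𝔹 = ℂ²`:
holomorphic components satisfying the bicomplex Cauchy–Riemann equations. -/
def BicomplexHoloOn (ψ : ℂ × ℂ → ℂ × ℂ) (U : Set (ℂ × ℂ)) : Prop :=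
  DifferentiableOn ℂ (fun q => (ψ q).1) U ∧ DifferentiableOn ℂ (fun q => (ψ q).2) U ∧
  ∀ p ∈ U,
    fderiv ℂ (fun q => (ψ q).1) p ((1 : ℂ), (0 : ℂ)) =
      fderiv ℂ (fun q => (ψ q).2) p ((0 : ℂ), (1 : ℂ)) ∧
    fderiv ℂ (fun q => (ψ q).1) p ((0 : ℂ), (1 : ℂ)) =
      - fderiv ℂ (fun q => (ψ q).2) p ((1 : ℂ), (0 : ℂ))

theorem continuous_iotaC : Continuous iotaC := by
  unfold iotaC; fun_prop

theorem iotaC_injective : Function.Injective iotaC := fun z w h => by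
  simp only [iotaC, Prod.mk.injEq, Complex.ofReal_inj] at h
  exact Complex.ext h.1 h.2

/-- For a bicomplex-holomorphic map `ψ` and a square root `c` of `-1`, the function `ψ₁ + c ψ₂`
is locally constant in the direction `(1, c)`. -/
theorem BicomplexHoloOn.add_mul_eq_of_convex {ψ : ℂ × ℂ → ℂ × ℂ} {U S : Set (ℂ × ℂ)}
    (hψ : BicomplexHoloOn ψ U) (hU : IsOpen U) (hS : IsOpen S) (hSc : Convex ℝ S) (hSU : S ⊆ U)
    {c : ℂ} (hc : c * c = -1) {p q : ℂ × ℂ} (hp : p ∈ S) (hq : q ∈ S)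
    (hpq : p.1 + c * p.2 = q.1 + c * q.2) :
    (ψ p).1 + c * (ψ p).2 = (ψ q).1 + c * (ψ q).2 := by
  obtain ⟨h₁, h₂, hCR⟩ := hψ
  set γ : ℂ → ℂ × ℂ := fun s => (q.1 + s, q.2 + s * c) with hγ
  have hγc : Continuous γ := by fun_prop
  have hγd (s : ℂ) : HasDerivAt γ (1, c) s := by
    simpa using ((hasDerivAt_id s).const_add q.1).prodMk
      (((hasDerivAt_id s).mul_const c).const_add q.2)
  have hconv : Convex ℝ (γ ⁻¹' S) := by
    intro s hs t ht a b ha hb hab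
    have := hSc hs ht ha hb hab
    simp only [Set.mem_preimage]
    convert this using 1
    have hab' : (a : ℂ) + b = 1 := by exact_mod_cast hab
    ext1
    · simp only [hγ, Complex.real_smul, Prod.fst_add, Prod.smul_fst]
      linear_combination (-q.1) * hab'
    · simp only [hγ, Complex.real_smul, Prod.snd_add, Prod.smul_snd]
      linear_combination (-q.2) * hab'
  have hd (s : ℂ) (hs : s ∈ γ ⁻¹' S) :
      HasDerivAt (fun s => (ψ (γ s)).1 + c * (ψ (γ s)).2) 0 s := by
    have hsU := hSU hs
    have e₁ := ((h₁.differentiableAt (hU.mem_nhds hsU)).hasFDerivAt).comp_hasDerivAt s (hγd s)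
    have e₂ := ((h₂.differentiableAt (hU.mem_nhds hsU)).hasFDerivAt).comp_hasDerivAt s (hγd s)
    refine (e₁.add (e₂.const_mul c)).congr_deriv ?_
    obtain ⟨k₁, k₂⟩ := hCR _ hsU
    have hv : ((1 : ℂ), c) = ((1 : ℂ), (0 : ℂ)) + c • ((0 : ℂ), (1 : ℂ)) := by simp
    rw [hv, map_add, map_add, map_smul, map_smul, k₁, k₂, smul_eq_mul, smul_eq_mul]
    linear_combination
      (fderiv ℂ (fun q => (ψ q).2) (γ s) ((0 : ℂ), (1 : ℂ))) * hc
  have hq0 : γ 0 = q := by simp [hγ]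
  have hpt : γ (p.1 - q.1) = p := by
    ext1
    · simp [hγ]
    · simp only [hγ]
      linear_combination c * hpq + (q.2 - p.2) * hc
  have := (hS.preimage hγc).is_const_of_deriv_eq_zero hconv.isPreconnected
    (fun s hs => (hd s hs).differentiableAt.differentiableWithinAt)
    (fun s hs => (hd s hs).deriv)
    (show p.1 - q.1 ∈ γ ⁻¹' S by simpa [hpt] using hp)
    (show (0 : ℂ) ∈ γ ⁻¹' S by simpa [hq0] using hq)
  simpa only [hq0, hpt] using this

/-- Two bicomplex-holomorphic maps agreeing on the slice `ι_ℂ(ℂ)` agree near the slice. -/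
theorem BicomplexHoloOn.eventuallyEq_of_eqOn_range {ψ₁ ψ₂ : ℂ × ℂ → ℂ × ℂ} {U : Set (ℂ × ℂ)}
    (h₁ : BicomplexHoloOn ψ₁ U) (h₂ : BicomplexHoloOn ψ₂ U) (hU : IsOpen U)
    (h : ∀ z, iotaC z ∈ U → ψ₁ (iotaC z) = ψ₂ (iotaC z)) {z : ℂ} (hz : iotaC z ∈ U) :
    ψ₁ =ᶠ[nhds (iotaC z)] ψ₂ := by
  obtain ⟨r, hr, hB⟩ := Metric.isOpen_iff.1 hU _ hz
  set B := Metric.ball (iotaC z) r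
  have hBo : IsOpen B := Metric.isOpen_ball
  have hzB : iotaC z ∈ B := Metric.mem_ball_self hr
  have key {c : ℂ} (hc : c * c = -1) {w q : ℂ × ℂ} (hw : w ∈ Set.range iotaC) (hwB : w ∈ B)
      (hq : q ∈ B) (hqw : q.1 + c * q.2 = w.1 + c * w.2) :
      (ψ₁ q).1 + c * (ψ₁ q).2 = (ψ₂ q).1 + c * (ψ₂ q).2 := by
    obtain ⟨w, rfl⟩ := hw
    rw [h₁.add_mul_eq_of_convex hU hBo (convex_ball _ _) hB hc hq hwB hqw,
      h₂.add_mul_eq_of_convex hU hBo (convex_ball _ _) hB hc hq hwB hqw, h w (hB hwB)]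
  have ev₁ : ∀ᶠ q : ℂ × ℂ in nhds (iotaC z), iotaC (q.1 + Complex.I * q.2) ∈ B := by
    have hc : Continuous fun q : ℂ × ℂ => iotaC (q.1 + Complex.I * q.2) :=
      continuous_iotaC.comp (by fun_prop)
    refine hc.continuousAt.eventually_mem (hBo.mem_nhds ?_)
    convert hzB using 2
    apply Complex.ext <;> simp [iotaC]
  have ev₂ : ∀ᶠ q : ℂ × ℂ in nhds (iotaC z),
      iotaC (starRingEnd ℂ (q.1 - Complex.I * q.2)) ∈ B := by
    have hc : Continuous fun q : ℂ × ℂ => iotaC (starRingEnd ℂ (q.1 - Complex.I * q.2)) :=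
      continuous_iotaC.comp (Complex.continuous_conj.comp (by fun_prop))
    refine hc.continuousAt.eventually_mem (hBo.mem_nhds ?_)
    convert hzB using 2
    apply Complex.ext <;> simp [iotaC]
  filter_upwards [hBo.mem_nhds hzB, ev₁, ev₂] with q hq hq₁ hq₂
  have k₁ := key Complex.I_mul_I ⟨_, rfl⟩ hq₁ hq (by
    apply Complex.ext <;> simp [iotaC])
  have k₂ := key (c := -Complex.I) (by simp) ⟨_, rfl⟩ hq₂ hq (by
    apply Complex.ext
    · simp [iotaC]
    · simp [iotaC]
      ring)
  ext1
  · linear_combination (k₁ + k₂) / 2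
  · linear_combination (-Complex.I / 2) * (k₁ - k₂) +
      ((ψ₁ q).2 - (ψ₂ q).2) * Complex.I_mul_I

theorem BicomplexHoloOn.mono {ψ : ℂ × ℂ → ℂ × ℂ} {U V : Set (ℂ × ℂ)}
    (hψ : BicomplexHoloOn ψ U) (hVU : V ⊆ U) : BicomplexHoloOn ψ V :=
  ⟨hψ.1.mono hVU, hψ.2.1.mono hVU, fun p hp => hψ.2.2 p (hVU hp)⟩

/-- The idempotent combination of holomorphic functions `g` of `q₁ + i q₂` and `h` of `q₁ - i q₂`
is bicomplex-holomorphic. -/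
theorem bicomplexHoloOn_of_differentiableAt {g h : ℂ → ℂ} {U : Set (ℂ × ℂ)}
    (hg : ∀ q ∈ U, DifferentiableAt ℂ g (q.1 + Complex.I * q.2))
    (hh : ∀ q ∈ U, DifferentiableAt ℂ h (q.1 - Complex.I * q.2)) :
    BicomplexHoloOn (fun q =>
      ((g (q.1 + Complex.I * q.2) + h (q.1 - Complex.I * q.2)) / 2,
        (g (q.1 + Complex.I * q.2) - h (q.1 - Complex.I * q.2)) / (2 * Complex.I))) U := by
  have hfst (q : ℂ × ℂ) : HasFDerivAt (fun q : ℂ × ℂ => q.1) (ContinuousLinearMap.fst ℂ ℂ ℂ) q :=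
    hasFDerivAt_fst
  have hsnd (q : ℂ × ℂ) : HasFDerivAt (fun q : ℂ × ℂ => q.2) (ContinuousLinearMap.snd ℂ ℂ ℂ) q :=
    hasFDerivAt_snd
  have e₁ (q) (hq : q ∈ U) := (hg q hq).hasDerivAt.comp_hasFDerivAt q
    ((hfst q).add ((hsnd q).const_mul Complex.I))
  have e₂ (q) (hq : q ∈ U) := (hh q hq).hasDerivAt.comp_hasFDerivAt q
    ((hfst q).sub ((hsnd q).const_mul Complex.I))
  have d₁ (q) (hq : q ∈ U) := ((e₁ q hq).add (e₂ q hq)).mul_const (2⁻¹ : ℂ)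
  have d₂ (q) (hq : q ∈ U) := ((e₁ q hq).sub (e₂ q hq)).mul_const ((2 * Complex.I)⁻¹ : ℂ)
  refine ⟨fun q hq => (d₁ q hq).differentiableAt.differentiableWithinAt,
    fun q hq => (d₂ q hq).differentiableAt.differentiableWithinAt, fun q hq => ?_⟩
  have f₁ := (d₁ q hq).fderiv
  have f₂ := (d₂ q hq).fderiv
  simp only [Function.comp_apply, Pi.add_apply, Pi.sub_apply] at f₁ f₂
  simp only [div_eq_mul_inv, f₁, f₂]
  constructor
  · simp only [smul_apply, add_apply, sub_apply, ContinuousLinearMap.coe_fst',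
      ContinuousLinearMap.coe_snd', smul_eq_mul, mul_inv, Complex.inv_I]
    linear_combination (deriv g (q.1 + Complex.I * q.2) + deriv h (q.1 - Complex.I * q.2)) / 2 *
      Complex.I_mul_I
  · simp only [smul_apply, add_apply, sub_apply, ContinuousLinearMap.coe_fst',
      ContinuousLinearMap.coe_snd', smul_eq_mul, mul_inv, Complex.inv_I]
    ring

/-- The embedding `ι_ℂ` as a continuous real-linear map. -/
def iotaCLM : ℂ →L[ℝ] ℂ × ℂ :=
  (Complex.ofRealCLM.comp Complex.reCLM).prod (Complex.ofRealCLM.comp Complex.imCLM)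

theorem BicomplexHoloOn.hasFDerivAt_comp_iotaC {ψ : ℂ × ℂ → ℂ × ℂ} {U : Set (ℂ × ℂ)}
    (hψ : BicomplexHoloOn ψ U) (hU : IsOpen U) {z : ℂ} (hz : iotaC z ∈ U) :
    HasFDerivAt (fun w => ψ (iotaC w))
      ((((fderiv ℂ (fun q => (ψ q).1) (iotaC z)).prod
        (fderiv ℂ (fun q => (ψ q).2) (iotaC z))).restrictScalars ℝ).comp iotaCLM) z := by
  have e₁ := (hψ.1.differentiableAt (hU.mem_nhds hz)).hasFDerivAt
  have e₂ := (hψ.2.1.differentiableAt (hU.mem_nhds hz)).hasFDerivAt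
  exact HasFDerivAt.comp z ((e₁.prodMk e₂).restrictScalars ℝ) (iotaCLM.hasFDerivAt (x := z))

/-- holomorphic functions on open subsets of ℂ extend, germ-uniquely, to
bicomplex-holomorphic maps; conversely restrictions of bicomplex-holomorphic maps to
the slice `ι_ℂ(ℂ)` are holomorphic with respect to `i₂`. -/
theorem holomorphic_extends_bicomplex (U : Set ℂ) (hU : IsOpen U)
    (f : ℂ → ℂ) (hf : DifferentiableOn ℂ f U) :
    -- (1) existence of a bicomplex-holomorphic extension
    (∃ (Ut : Set (ℂ × ℂ)) (ψ : ℂ × ℂ → ℂ × ℂ), IsOpen Ut ∧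
        Ut ∩ Set.range iotaC = iotaC '' U ∧ BicomplexHoloOn ψ Ut ∧
        ∀ z ∈ U, ψ (iotaC z) = iotaC (f z)) ∧
    -- (2) uniqueness of the germ of the extension along `ι_ℂ(U)`
    (∀ (Ut₁ Ut₂ : Set (ℂ × ℂ)) (ψ₁ ψ₂ : ℂ × ℂ → ℂ × ℂ),
        IsOpen Ut₁ → Ut₁ ∩ Set.range iotaC = iotaC '' U → BicomplexHoloOn ψ₁ Ut₁ →
        (∀ z ∈ U, ψ₁ (iotaC z) = iotaC (f z)) →
        IsOpen Ut₂ → Ut₂ ∩ Set.range iotaC = iotaC '' U → BicomplexHoloOn ψ₂ Ut₂ →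
        (∀ z ∈ U, ψ₂ (iotaC z) = iotaC (f z)) →
        ∃ W : Set (ℂ × ℂ), IsOpen W ∧ iotaC '' U ⊆ W ∧ W ⊆ Ut₁ ∩ Ut₂ ∧
          Set.EqOn ψ₁ ψ₂ W) ∧
    -- (3) restriction of a bicomplex-holomorphic map is holomorphic w.r.t. `i₂`:
    -- `F(x+yi) := ψ(x,y)` satisfies `∂F/∂y = i₂·∂F/∂x`
    (∀ (Ut : Set (ℂ × ℂ)) (ψ : ℂ × ℂ → ℂ × ℂ), IsOpen Ut → BicomplexHoloOn ψ Ut →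
        {z : ℂ | iotaC z ∈ Ut}.Nonempty →
        ∀ z : ℂ, iotaC z ∈ Ut →
          DifferentiableAt ℝ (fun w : ℂ => ψ (iotaC w)) z ∧
          fderiv ℝ (fun w : ℂ => ψ (iotaC w)) z Complex.I =
            bmul ((0 : ℂ), (1 : ℂ)) (fderiv ℝ (fun w : ℂ => ψ (iotaC w)) z 1)) := by
  refine ⟨?_, ?_, ?_⟩
  · have hfd (z) (hz : z ∈ U) : DifferentiableAt ℂ f z := hf.differentiableAt (hU.mem_nhds hz)
    refine ⟨{q | q.1 + Complex.I * q.2 ∈ U ∧ starRingEnd ℂ (q.1 - Complex.I * q.2) ∈ U}, _,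
      (hU.preimage (by fun_prop)).inter
        (hU.preimage (Complex.continuous_conj.comp (by fun_prop))), ?_,
      bicomplexHoloOn_of_differentiableAt (g := f)
        (h := fun w => starRingEnd ℂ (f (starRingEnd ℂ w)))
        (fun q hq => hfd _ hq.1) (fun q hq => ?_), ?_⟩
    · have h₁ (z : ℂ) : (iotaC z).1 + Complex.I * (iotaC z).2 = z := by
        apply Complex.ext <;> simp [iotaC]
      have h₂ (z : ℂ) : starRingEnd ℂ ((iotaC z).1 - Complex.I * (iotaC z).2) = z := by
        apply Complex.ext <;> simp [iotaC]
      ext q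
      constructor
      · rintro ⟨hq, z, rfl⟩
        exact ⟨z, h₁ z ▸ hq.1, rfl⟩
      · rintro ⟨z, hz, rfl⟩
        exact ⟨⟨(h₁ z).symm ▸ hz, (h₂ z).symm ▸ hz⟩, z, rfl⟩
    · have := (hfd _ hq.2).conj_conj
      rwa [Complex.conj_conj] at this
    · intro z hz
      have h₁ : (iotaC z).1 + Complex.I * (iotaC z).2 = z := by
        apply Complex.ext <;> simp [iotaC]
      have h₂ : starRingEnd ℂ ((iotaC z).1 - Complex.I * (iotaC z).2) = z := by
        apply Complex.ext <;> simp [iotaC]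
      simp only [h₁, h₂]
      simp only [iotaC, Complex.re_eq_add_conj, Complex.im_eq_sub_conj]
  · intro Ut₁ Ut₂ ψ₁ ψ₂ ho₁ hr₁ hψ₁ hf₁ ho₂ hr₂ hψ₂ hf₂
    refine ⟨interior {q | q ∈ Ut₁ ∩ Ut₂ ∧ ψ₁ q = ψ₂ q}, isOpen_interior, ?_,
      fun q hq => (interior_subset hq).1, fun q hq => (interior_subset hq).2⟩
    rintro _ ⟨z, hz, rfl⟩
    have hz₁ : iotaC z ∈ Ut₁ := (hr₁.symm.subset ⟨z, hz, rfl⟩).1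
    have hz₂ : iotaC z ∈ Ut₂ := (hr₂.symm.subset ⟨z, hz, rfl⟩).1
    have hev := (hψ₁.mono Set.inter_subset_left).eventuallyEq_of_eqOn_range
      (hψ₂.mono Set.inter_subset_right) (ho₁.inter ho₂) (fun w hw => by
        have hwU : w ∈ U := by
          obtain ⟨w', hw', h⟩ := hr₁.subset ⟨hw.1, w, rfl⟩
          exact iotaC_injective h ▸ hw'
        rw [hf₁ w hwU, hf₂ w hwU]) ⟨hz₁, hz₂⟩
    exact mem_interior_iff_mem_nhds.2
      (Filter.inter_mem ((ho₁.inter ho₂).mem_nhds ⟨hz₁, hz₂⟩) hev)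
  · intro Ut ψ hUt hψ _ z hz
    have hd := hψ.hasFDerivAt_comp_iotaC hUt hz
    refine ⟨hd.differentiableAt, ?_⟩
    obtain ⟨k₁, k₂⟩ := hψ.2.2 _ hz
    rw [hd.fderiv]
    simp [iotaCLM, bmul, k₁, k₂]
end
end

section
/- (Ringleb's Lemma.) Let U ⊆ ℂ² (identified with 𝔹) be open and let ψ = ψ₁ + ψ₂i₂ : U → 𝔹 with ψ₁, ψ₂ : U → ℂ holomorphic. Then ψ is bicomplex-holomorphic on U if and only if every point of U has an open neighbourhood V ⊆ U on which there exist holomorphic functions f₁ and f₂, defined on the open sets {q₁ + iq₂ : (q₁,q₂) ∈ V} and {q₁ − iq₂ : (q₁,q₂) ∈ V} respectively, such that ψ₁(q₁,q₂) + iψ₂(q₁,q₂) = f₁(q₁ + iq₂) and ψ₁(q₁,q₂) − iψ₂(q₁,q₂) = f₂(q₁ − iq₂) for all (q₁,q₂) ∈ V. (Equivalently, with a := (1−j)/2 and b := (1+j)/2 where j := i₁i₂ = (0,i), and q = za + wb with z = q₁ + iq₂, w = q₁ − iq₂: ψ(q) = f₁(z)a + f₂(w)b.) -/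
noncomputable section

/-- A function which near `p` depends only on `q₁ + c q₂` has vanishing derivative in the
direction `(-c, 1)`. -/
theorem fderiv_eq_zero_of_factor {φ : ℂ × ℂ → ℂ} {V : Set (ℂ × ℂ)} (hV : IsOpen V)
    {p : ℂ × ℂ} (hp : p ∈ V) (c : ℂ) (hφ : DifferentiableAt ℂ φ p) (f : ℂ → ℂ)
    (hf : ∀ q ∈ V, φ q = f (q.1 + c * q.2)) : fderiv ℂ φ p (-c, 1) = 0 := by
  have hline : HasDerivAt (fun t : ℂ => p + t • ((-c, 1) : ℂ × ℂ)) (-c, 1) 0 := by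
    simpa using ((hasDerivAt_id (0 : ℂ)).smul_const ((-c, 1) : ℂ × ℂ)).const_add p
  have hcomp : HasDerivAt (fun t : ℂ => φ (p + t • ((-c, 1) : ℂ × ℂ)))
      (fderiv ℂ φ p (-c, 1)) 0 :=
    HasFDerivAt.comp_hasDerivAt_of_eq 0 hφ.hasFDerivAt hline (by simp)
  have hmem : ∀ᶠ t : ℂ in nhds 0, p + t • ((-c, 1) : ℂ × ℂ) ∈ V :=
    hline.continuousAt.eventually_mem (by simpa using hV.mem_nhds hp)
  refine hcomp.unique ((hasDerivAt_const (0 : ℂ) (φ p)).congr_of_eventuallyEq ?_)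
  filter_upwards [hmem] with t ht
  rw [hf _ ht, hf p hp]
  congr 1
  simp
  ring

/-- If `c² = -1` and the derivative of `φ` in the direction `(-c, 1)` vanishes on a ball, then on
that ball `φ` is a holomorphic function of `q₁ + c q₂`. -/
theorem exists_factor_on_ball {φ : ℂ × ℂ → ℂ} {p : ℂ × ℂ} {r : ℝ} {c : ℂ} (hc : c * c = -1)
    (hφ : DifferentiableOn ℂ φ (Metric.ball p r))
    (h0 : ∀ q ∈ Metric.ball p r, fderiv ℂ φ q (-c, 1) = 0) :
    ∃ f : ℂ → ℂ,
      DifferentiableOn ℂ f ((fun q : ℂ × ℂ => q.1 + c * q.2) '' Metric.ball p r) ∧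
      ∀ q ∈ Metric.ball p r, φ q = f (q.1 + c * q.2) := by
  have hnorm : ‖c‖ = 1 := by
    have h : ‖c‖ * ‖c‖ = 1 := by rw [← norm_mul, hc]; simp
    nlinarith [norm_nonneg c]
  let s : ℂ → ℂ × ℂ := fun z =>
    (p.1 + (z - (p.1 + c * p.2)) / 2, p.2 - c * ((z - (p.1 + c * p.2)) / 2))
  have hs : Differentiable ℂ s := by
    intro z
    dsimp only [s]
    fun_prop
  have hmem : ∀ q ∈ Metric.ball p r, s (q.1 + c * q.2) ∈ Metric.ball p r := by
    intro q hq
    have hδ : ‖(q.1 + c * q.2 - (p.1 + c * p.2)) / 2‖ < r := by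
      rw [Metric.mem_ball, Prod.dist_eq, max_lt_iff, dist_eq_norm, dist_eq_norm] at hq
      have h : ‖q.1 + c * q.2 - (p.1 + c * p.2)‖ ≤ ‖q.1 - p.1‖ + ‖q.2 - p.2‖ := by
        calc _ = ‖(q.1 - p.1) + c * (q.2 - p.2)‖ := by congr 1; ring
          _ ≤ ‖q.1 - p.1‖ + ‖c * (q.2 - p.2)‖ := norm_add_le _ _
          _ = _ := by rw [norm_mul, hnorm, one_mul]
      rw [norm_div, Complex.norm_ofNat]
      linarith [hq.1, hq.2]
    rw [Metric.mem_ball, Prod.dist_eq, max_lt_iff, dist_eq_norm, dist_eq_norm]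
    constructor
    · simpa only [s, add_sub_cancel_left] using hδ
    · simpa only [s, sub_sub_cancel_left, norm_neg, norm_mul, hnorm, one_mul] using hδ
  refine ⟨fun z => φ (s z), ?_, ?_⟩
  · refine hφ.comp hs.differentiableOn ?_
    rintro _ ⟨q, hq, rfl⟩
    exact hmem q hq
  · intro q hq
    let l : ℂ → ℂ × ℂ := fun t => q + t • ((-c, 1) : ℂ × ℂ)
    have hl : ∀ t, HasDerivAt l (-c, 1) t := fun t => by
      have h := ((hasDerivAt_id t).smul_const ((-c, 1) : ℂ × ℂ)).const_add q
      rwa [one_smul] at h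
    have hcont : Continuous l := continuous_iff_continuousAt.2 fun t => (hl t).continuousAt
    have hopen : IsOpen (l ⁻¹' Metric.ball p r) := Metric.isOpen_ball.preimage hcont
    have hconv : Convex ℝ (l ⁻¹' Metric.ball p r) := by
      intro x hx y hy a b ha hb hab
      have hxy : l (a • x + b • y) = a • l x + b • l y := by
        have hab' : (a : ℂ) + b = 1 := by exact_mod_cast hab
        ext
        · simp [l]
          linear_combination (-q.1) * hab'
        · simp [l]
          linear_combination (-q.2) * hab'
      rw [Set.mem_preimage, hxy]
      exact convex_ball p r hx hy ha hb hab
    have hderiv : ∀ t ∈ l ⁻¹' Metric.ball p r, HasDerivAt (fun t => φ (l t)) 0 t := by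
      intro t ht
      have h := ((hφ.differentiableAt
        (Metric.isOpen_ball.mem_nhds ht)).hasFDerivAt).comp_hasDerivAt t (hl t)
      rwa [h0 _ ht] at h
    have hq0 : l 0 = q := by simp [l]
    have hq1 : l ((s (q.1 + c * q.2)).2 - q.2) = s (q.1 + c * q.2) := by
      ext
      · simp only [l, s, Prod.fst_add, Prod.smul_fst, smul_eq_mul]
        linear_combination ((q.1 + c * q.2 - (p.1 + c * p.2)) / 2) * hc
      · simp [l]
    have key := hopen.is_const_of_deriv_eq_zero hconv.isPreconnected
      (fun t ht => (hderiv t ht).differentiableAt.differentiableWithinAt)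
      (fun t ht => (hderiv t ht).deriv)
      (show (0 : ℂ) ∈ l ⁻¹' Metric.ball p r by rwa [Set.mem_preimage, hq0])
      (show (s (q.1 + c * q.2)).2 - q.2 ∈ l ⁻¹' Metric.ball p r by
        rw [Set.mem_preimage, hq1]; exact hmem q hq)
    simpa only [hq0, hq1] using key

/-- The derivative of `ψ₁ + c ψ₂` in the direction `(-c, 1)`, when `c² = -1`. -/
theorem fderiv_add_const_mul_apply {g h : ℂ × ℂ → ℂ} {p : ℂ × ℂ} {c : ℂ} (hc : c * c = -1)
    (hg : DifferentiableAt ℂ g p) (hh : DifferentiableAt ℂ h p) :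
    fderiv ℂ (fun q => g q + c * h q) p (-c, 1) =
      (fderiv ℂ g p (0, 1) + fderiv ℂ h p (1, 0)) -
        c * (fderiv ℂ g p (1, 0) - fderiv ℂ h p (0, 1)) := by
  have hv : ((-c, 1) : ℂ × ℂ) = (-c) • ((1, 0) : ℂ × ℂ) + (0, 1) := by simp
  have hd : HasFDerivAt (fun q => g q + c * h q) (fderiv ℂ g p + c • fderiv ℂ h p) p :=
    hg.hasFDerivAt.add (hh.hasFDerivAt.const_mul c)
  rw [hd.fderiv, hv]
  simp only [_root_.add_apply, _root_.smul_apply, map_add, map_smul,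
    smul_eq_mul]
  linear_combination (-(fderiv ℂ h p (1, 0))) * hc

/-- Ringleb's Lemma: `ψ = ψ₁ + ψ₂ i₂` with holomorphic components is
bicomplex-holomorphic on `U` iff locally `ψ₁ + iψ₂` and `ψ₁ − iψ₂` factor through
holomorphic functions of `q₁ + i q₂` and `q₁ − i q₂` respectively. -/
theorem ringleb (U : Set (ℂ × ℂ)) (hU : IsOpen U) (ψ : ℂ × ℂ → ℂ × ℂ)
    (h1 : DifferentiableOn ℂ (fun q => (ψ q).1) U)
    (h2 : DifferentiableOn ℂ (fun q => (ψ q).2) U) :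
    BicomplexHoloOn ψ U ↔
      ∀ p ∈ U, ∃ V : Set (ℂ × ℂ), IsOpen V ∧ p ∈ V ∧ V ⊆ U ∧
        ∃ f₁ f₂ : ℂ → ℂ,
          DifferentiableOn ℂ f₁ ((fun q : ℂ × ℂ => q.1 + Complex.I * q.2) '' V) ∧
          DifferentiableOn ℂ f₂ ((fun q : ℂ × ℂ => q.1 - Complex.I * q.2) '' V) ∧
          ∀ q ∈ V,
            (ψ q).1 + Complex.I * (ψ q).2 = f₁ (q.1 + Complex.I * q.2) ∧
            (ψ q).1 - Complex.I * (ψ q).2 = f₂ (q.1 - Complex.I * q.2) := by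
  have hI : Complex.I * Complex.I = -1 := Complex.I_mul_I
  have hI' : -Complex.I * -Complex.I = -1 := by simp
  have d1 : ∀ p ∈ U, DifferentiableAt ℂ (fun q => (ψ q).1) p := fun p hp =>
    h1.differentiableAt (hU.mem_nhds hp)
  have d2 : ∀ p ∈ U, DifferentiableAt ℂ (fun q => (ψ q).2) p := fun p hp =>
    h2.differentiableAt (hU.mem_nhds hp)
  constructor
  · rintro ⟨-, -, hCR⟩ p hp
    obtain ⟨r, hr, hrU⟩ := Metric.isOpen_iff.1 hU p hp
    have factor : ∀ c : ℂ, c * c = -1 → ∃ f : ℂ → ℂ,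
        DifferentiableOn ℂ f ((fun q : ℂ × ℂ => q.1 + c * q.2) '' Metric.ball p r) ∧
        ∀ q ∈ Metric.ball p r, (ψ q).1 + c * (ψ q).2 = f (q.1 + c * q.2) := by
      intro c hc
      refine exists_factor_on_ball (φ := fun q => (ψ q).1 + c * (ψ q).2) hc
        ((h1.add (h2.const_mul c)).mono hrU) fun q hq => ?_
      rw [fderiv_add_const_mul_apply hc (d1 q (hrU hq)) (d2 q (hrU hq)),
        (hCR q (hrU hq)).1, (hCR q (hrU hq)).2]
      ring
    obtain ⟨f₁, hf₁, e₁⟩ := factor _ hI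
    obtain ⟨f₂, hf₂, e₂⟩ := factor _ hI'
    simp only [neg_mul, ← sub_eq_add_neg] at hf₂ e₂
    exact ⟨Metric.ball p r, Metric.isOpen_ball, Metric.mem_ball_self hr, hrU, f₁, f₂, hf₁, hf₂,
      fun q hq => ⟨e₁ q hq, e₂ q hq⟩⟩
  · intro H
    refine ⟨h1, h2, fun p hp => ?_⟩
    obtain ⟨V, hV, hpV, -, f₁, f₂, -, -, e⟩ := H p hp
    have a₁ := fderiv_eq_zero_of_factor (φ := fun q => (ψ q).1 + Complex.I * (ψ q).2) hV hpV
      Complex.I ((d1 p hp).add ((d2 p hp).const_mul _)) f₁ fun q hq => (e q hq).1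
    have a₂ := fderiv_eq_zero_of_factor (φ := fun q => (ψ q).1 + -Complex.I * (ψ q).2) hV hpV
      (-Complex.I) ((d1 p hp).add ((d2 p hp).const_mul _)) f₂ fun q hq => by
        simpa only [neg_mul, ← sub_eq_add_neg] using (e q hq).2
    rw [fderiv_add_const_mul_apply hI (d1 p hp) (d2 p hp)] at a₁
    rw [fderiv_add_const_mul_apply hI' (d1 p hp) (d2 p hp)] at a₂
    constructor
    · refine mul_left_cancel₀ Complex.I_ne_zero ?_
      linear_combination (a₂ - a₁) / 2
    · linear_combination (a₁ + a₂) / 2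
end
end

section
/- (Fundamental characterization, flat case.) A holomorphic map Φ = (Φ₁,…,Φₙ) : U → ℂⁿ on an open set U ⊆ ℂ^m is a complex-harmonic morphism if and only if it is complex-harmonic and complex-horizontally weakly conformal; explicitly, if and only if there is a (holomorphic) function Λ : U → ℂ such that (a) Δ_ℂ Φ_α = 0 for every α = 1,…,n, and (b) ⟨grad_ℂ Φ_α, grad_ℂ Φ_β⟩_ℂ = δ_{αβ}·Λ for all α, β = 1,…,n. -/
noncomputable section

/-- Complex Laplacian of `f : ℂ^m → ℂ`. -/
def lapC {m : ℕ} (f : (Fin m → ℂ) → ℂ) (p : Fin m → ℂ) : ℂ :=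
  ∑ k, fderiv ℂ (fun z => fderiv ℂ f z (Pi.single k 1)) p (Pi.single k 1)

/-- Complex gradient of `f : ℂ^m → ℂ`. -/
def gradC {m : ℕ} (f : (Fin m → ℂ) → ℂ) (p : Fin m → ℂ) : Fin m → ℂ :=
  fun k => fderiv ℂ f p (Pi.single k 1)

/-- Complex-bilinear inner product on `ℂ^m`. -/
def innC {m : ℕ} (u v : Fin m → ℂ) : ℂ := ∑ k, u k * v k

/-- Complex-harmonic (holomorphic) function on an open set `V ⊆ ℂ^m`. -/
def ComplexHarmonicOn {m : ℕ} (f : (Fin m → ℂ) → ℂ) (V : Set (Fin m → ℂ)) : Prop :=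
  DifferentiableOn ℂ f V ∧ ∀ p ∈ V, lapC f p = 0

/-- Complex-harmonic morphism `ℂ^m ⊇ U → ℂⁿ`: pulls back complex-harmonic functions
on open subsets of `ℂⁿ` to complex-harmonic functions. -/
def IsCHM {m n : ℕ} (Φ : (Fin m → ℂ) → (Fin n → ℂ)) (U : Set (Fin m → ℂ)) : Prop :=
  ∀ V : Set (Fin n → ℂ), IsOpen V → ∀ f : (Fin n → ℂ) → ℂ,
    ComplexHarmonicOn f V → (U ∩ Φ ⁻¹' V).Nonempty →
      ComplexHarmonicOn (f ∘ Φ) (U ∩ Φ ⁻¹' V)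

open Metric Set MeasureTheory Filter Topology

/-- Directional derivatives of a holomorphic function on an open subset of a finite-dimensional
space are holomorphic. -/
theorem DifferentiableOn.fderiv_apply_of_isOpen {E : Type*} [NormedAddCommGroup E]
    [NormedSpace ℂ E] [FiniteDimensional ℂ E] {f : E → ℂ} {V : Set E} (hV : IsOpen V)
    (hf : DifferentiableOn ℂ f V) (v : E) :
    DifferentiableOn ℂ (fun z => fderiv ℂ f z v) V := by
  intro p hp
  refine DifferentiableAt.differentiableWithinAt ?_
  have : ProperSpace E := FiniteDimensional.proper ℂ E
  borelize E
  obtain ⟨R, hR, hRV⟩ := nhds_basis_closedBall.mem_iff.mp (hV.mem_nhds hp)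
  obtain ⟨r, hr, hrR⟩ : ∃ r : ℝ, 0 < r ∧ r * (‖v‖ + 2) ≤ R :=
    ⟨R / (‖v‖ + 2), by positivity, by field_simp; rfl⟩
  obtain ⟨M, hM⟩ := (isCompact_closedBall p R).exists_bound_of_continuousOn
    (hf.continuousOn.mono hRV)
  have hmem : ∀ z ∈ ball p r, ∀ ζ : ℂ, ‖ζ‖ ≤ r → ball (z + ζ • v) r ⊆ closedBall p R := by
    intro z hz ζ hζ w hw
    rw [mem_ball, dist_eq_norm] at hz hw
    rw [mem_closedBall, dist_eq_norm]
    have h1 : w - p = (w - (z + ζ • v)) + (z - p) + ζ • v := by abel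
    have h2 : ‖ζ • v‖ ≤ r * ‖v‖ := by
      rw [norm_smul]; gcongr
    calc ‖w - p‖ ≤ ‖w - (z + ζ • v)‖ + ‖z - p‖ + ‖ζ • v‖ := by
          rw [h1]; exact norm_add₃_le
      _ ≤ R := by linarith
  have hmemV : ∀ z ∈ ball p r, ∀ ζ : ℂ, ‖ζ‖ ≤ r → z + ζ • v ∈ V := fun z hz ζ hζ =>
    hRV (hmem z hz ζ hζ (mem_ball_self hr))
  have hdiff : ∀ z ∈ ball p r, ∀ ζ : ℂ, ‖ζ‖ ≤ r → DifferentiableAt ℂ f (z + ζ • v) :=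
    fun z hz ζ hζ => hf.differentiableAt (hV.mem_nhds (hmemV z hz ζ hζ))
  have hbound : ∀ z ∈ ball p r, ∀ ζ : ℂ, ‖ζ‖ ≤ r →
      ‖fderiv ℂ f (z + ζ • v)‖ ≤ (2 * M) / r := by
    intro z hz ζ hζ
    refine Complex.norm_fderiv_le_div_of_mapsTo_ball
      (hf.mono ((hmem z hz ζ hζ).trans hRV)) (fun w hw => ?_) hr
    rw [mem_closedBall, dist_eq_norm]
    have h1 := hM w (hmem z hz ζ hζ hw)
    have h2 := hM _ (hmem z hz ζ hζ (mem_ball_self hr))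
    linarith [norm_sub_le (f w) (f (z + ζ • v))]
  have hcauchy : ∀ z ∈ ball p r, fderiv ℂ f z v = (2 * Real.pi * Complex.I : ℂ)⁻¹ •
      ∮ ζ in C(0, r), (1 / (ζ - 0) ^ 2) • f (z + ζ • v) := by
    intro z hz
    have hline : ∀ ζ : ℂ, ‖ζ‖ ≤ r →
        HasDerivAt (fun ζ : ℂ => f (z + ζ • v)) (fderiv ℂ f (z + ζ • v) v) ζ := by
      intro ζ hζ
      have h1 : HasDerivAt (fun ζ : ℂ => z + ζ • v) v ζ := by
        simpa using ((hasDerivAt_id ζ).smul_const v).const_add z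
      exact (hdiff z hz ζ hζ).hasFDerivAt.comp_hasDerivAt ζ h1
    have h2 : DifferentiableOn ℂ (fun ζ : ℂ => f (z + ζ • v)) (closedBall 0 r) := fun ζ hζ =>
      (hline ζ (by simpa using hζ)).differentiableAt.differentiableWithinAt
    rw [h2.deriv_eq_smul_circleIntegral hr, (hline 0 (by simpa using hr.le)).deriv,
      inv_smul_smul₀ Complex.two_pi_I_ne_zero]
    simp
  have hball : ball p r ∈ 𝓝 p := ball_mem_nhds p hr
  refine DifferentiableAt.congr_of_eventuallyEq ?_ (eventually_of_mem hball hcauchy)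
  refine DifferentiableAt.const_smul (c := (2 * Real.pi * Complex.I : ℂ)⁻¹) ?_
  have hcm : ∀ t : ℝ, ‖circleMap 0 r t‖ ≤ r := fun t => by simp [abs_of_pos hr]
  set c : ℝ → ℂ := fun t =>
    _root_.deriv (circleMap 0 r) t * (1 / (circleMap 0 r t - 0) ^ 2) with hc
  have hc_cont : Continuous c := by
    have h0 : ∀ t, (circleMap 0 r t - 0) ^ 2 ≠ 0 := fun t => by
      simpa using hr.ne'
    have h1 : Continuous (circleMap 0 r) := continuous_circleMap 0 r
    simp only [hc, deriv_circleMap]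
    exact (by fun_prop : Continuous fun t => circleMap 0 r t * Complex.I).mul
      (continuous_const.div (by fun_prop) h0)
  have hF_cont : ∀ z ∈ ball p r, Continuous fun t : ℝ => c t * f (z + circleMap 0 r t • v) := by
    intro z hz
    refine hc_cont.mul (continuous_iff_continuousAt.mpr fun t => ?_)
    have h1 : Continuous fun t : ℝ => z + circleMap 0 r t • v :=
      continuous_const.add ((continuous_circleMap 0 r).smul continuous_const)
    exact (hdiff z hz _ (hcm t)).continuousAt.comp (f := fun t : ℝ => z + circleMap 0 r t • v)
      h1.continuousAt
  have hint := intervalIntegral.hasFDerivAt_integral_of_dominated_of_fderiv_le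
    (𝕜 := ℂ) (μ := volume) (a := 0) (b := 2 * Real.pi)
    (F := fun z t => c t * f (z + circleMap 0 r t • v))
    (F' := fun z t => c t • fderiv ℂ f (z + circleMap 0 r t • v))
    (bound := fun t => ‖c t‖ * (2 * M / r)) hball
    (eventually_of_mem hball fun z hz => (hF_cont z hz).aestronglyMeasurable)
    ((hF_cont p (mem_ball_self hr)).intervalIntegrable _ _)
    (by
      refine hc_cont.aestronglyMeasurable.smul ?_
      have h1 : Continuous fun t : ℝ => p + circleMap 0 r t • v :=
        continuous_const.add ((continuous_circleMap 0 r).smul continuous_const)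
      exact ((measurable_fderiv ℂ f).comp h1.measurable).aestronglyMeasurable)
    (ae_of_all _ fun t _ z hz => by
      rw [norm_smul]
      exact mul_le_mul_of_nonneg_left (hbound z hz _ (hcm t)) (norm_nonneg _))
    ((hc_cont.norm.mul continuous_const).intervalIntegrable _ _)
    (ae_of_all _ fun t _ z hz =>
      ((hasFDerivAt_comp_add_right _).mpr (hdiff z hz _ (hcm t)).hasFDerivAt).const_mul (c t))
  refine hint.differentiableAt.congr_of_eventuallyEq (Eventually.of_forall fun z => ?_)
  simp only [circleIntegral, hc, smul_eq_mul, mul_assoc]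

section Laplacian

variable {m n : ℕ}

theorem lapC_sub {f g : (Fin m → ℂ) → ℂ} {W : Set (Fin m → ℂ)} (hW : IsOpen W)
    (hf : DifferentiableOn ℂ f W) (hg : DifferentiableOn ℂ g W) {p : Fin m → ℂ} (hp : p ∈ W) :
    lapC (fun z => f z - g z) p = lapC f p - lapC g p := by
  simp only [lapC, ← Finset.sum_sub_distrib]
  refine Finset.sum_congr rfl fun k _ => ?_
  have hev : (fun z => fderiv ℂ (fun z => f z - g z) z (Pi.single k 1)) =ᶠ[𝓝 p]
      fun z => fderiv ℂ f z (Pi.single k 1) - fderiv ℂ g z (Pi.single k 1) :=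
    eventually_of_mem (hW.mem_nhds hp) fun z hz => by
      simp only [fderiv_fun_sub (hf.differentiableAt (hW.mem_nhds hz))
        (hg.differentiableAt (hW.mem_nhds hz)), sub_apply]
  rw [hev.fderiv_eq, fderiv_fun_sub
    ((hf.fderiv_apply_of_isOpen hW _).differentiableAt (hW.mem_nhds hp))
    ((hg.fderiv_apply_of_isOpen hW _).differentiableAt (hW.mem_nhds hp))]
  rfl

theorem lapC_mul {f g : (Fin m → ℂ) → ℂ} {W : Set (Fin m → ℂ)} (hW : IsOpen W)
    (hf : DifferentiableOn ℂ f W) (hg : DifferentiableOn ℂ g W) {p : Fin m → ℂ} (hp : p ∈ W) :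
    lapC (fun z => f z * g z) p =
      f p * lapC g p + g p * lapC f p + 2 * innC (gradC f p) (gradC g p) := by
  simp only [lapC, innC, gradC, Finset.mul_sum, ← Finset.sum_add_distrib]
  refine Finset.sum_congr rfl fun k _ => ?_
  have hev : (fun z => fderiv ℂ (fun z => f z * g z) z (Pi.single k 1)) =ᶠ[𝓝 p]
      fun z => f z * fderiv ℂ g z (Pi.single k 1) + g z * fderiv ℂ f z (Pi.single k 1) :=
    eventually_of_mem (hW.mem_nhds hp) fun z hz => by
      simp [fderiv_fun_mul (hf.differentiableAt (hW.mem_nhds hz))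
        (hg.differentiableAt (hW.mem_nhds hz))]
  have hf0 := hf.differentiableAt (hW.mem_nhds hp)
  have hg0 := hg.differentiableAt (hW.mem_nhds hp)
  have hf1 := (hf.fderiv_apply_of_isOpen hW (Pi.single k 1)).differentiableAt (hW.mem_nhds hp)
  have hg1 := (hg.fderiv_apply_of_isOpen hW (Pi.single k 1)).differentiableAt (hW.mem_nhds hp)
  rw [hev.fderiv_eq, fderiv_fun_add (hf0.fun_mul hg1) (hg0.fun_mul hf1), fderiv_fun_mul hf0 hg1,
    fderiv_fun_mul hg0 hf1]
  simp only [add_apply, smul_apply, smul_eq_mul]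
  ring

theorem fderiv_coord (α : Fin n) (w : Fin n → ℂ) :
    fderiv ℂ (fun w : Fin n → ℂ => w α) w = ContinuousLinearMap.proj α :=
  (ContinuousLinearMap.proj (R := ℂ) (φ := fun _ : Fin n => ℂ) α).fderiv

theorem lapC_coord (α : Fin n) (w : Fin n → ℂ) : lapC (fun w => w α) w = 0 := by
  simp [lapC, fderiv_coord]

theorem innC_gradC_coord (α β : Fin n) (w : Fin n → ℂ) :
    innC (gradC (fun w => w α) w) (gradC (fun w => w β) w) = if α = β then 1 else 0 := by
  simp [innC, gradC, fderiv_coord, Pi.single_apply]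

theorem complexHarmonicOn_coord (α : Fin n) :
    ComplexHarmonicOn (fun w : Fin n → ℂ => w α) univ :=
  ⟨by fun_prop, fun w _ => lapC_coord α w⟩

theorem complexHarmonicOn_coord_mul {α β : Fin n} (h : α ≠ β) :
    ComplexHarmonicOn (fun w : Fin n → ℂ => w α * w β) univ := by
  refine ⟨by fun_prop, fun w _ => ?_⟩
  rw [lapC_mul isOpen_univ (by fun_prop) (by fun_prop) (mem_univ w), lapC_coord, lapC_coord,
    innC_gradC_coord, if_neg h]
  ring

theorem complexHarmonicOn_coord_sq_sub (α β : Fin n) :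
    ComplexHarmonicOn (fun w : Fin n → ℂ => w α * w α - w β * w β) univ := by
  refine ⟨by fun_prop, fun w _ => ?_⟩
  rw [lapC_sub (f := fun w : Fin n → ℂ => w α * w α) (g := fun w : Fin n → ℂ => w β * w β)
      isOpen_univ (by fun_prop) (by fun_prop) (mem_univ w),
    lapC_mul isOpen_univ (by fun_prop) (by fun_prop) (mem_univ w),
    lapC_mul isOpen_univ (by fun_prop) (by fun_prop) (mem_univ w), lapC_coord, lapC_coord,
    innC_gradC_coord, innC_gradC_coord]
  simp

theorem fderiv_apply_eq_sum {f : (Fin n → ℂ) → ℂ} (w v : Fin n → ℂ) :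
    fderiv ℂ f w v = ∑ α, fderiv ℂ f w (Pi.single α 1) * v α := by
  conv_lhs => rw [pi_eq_sum_univ' v, map_sum]
  simp [mul_comm]

theorem fderiv_comp_apply_eq_sum {f : (Fin n → ℂ) → ℂ} {Φ : (Fin m → ℂ) → (Fin n → ℂ)}
    {z : Fin m → ℂ} (hf : DifferentiableAt ℂ f (Φ z)) (hΦ : DifferentiableAt ℂ Φ z)
    (v : Fin m → ℂ) :
    fderiv ℂ (fun z => f (Φ z)) z v =
      ∑ α, fderiv ℂ f (Φ z) (Pi.single α 1) * fderiv ℂ (fun z => Φ z α) z v := by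
  have h : fderiv ℂ (fun z => f (Φ z)) z = (fderiv ℂ f (Φ z)).comp (fderiv ℂ Φ z) :=
    fderiv_comp z hf hΦ
  rw [h, ContinuousLinearMap.comp_apply, fderiv_apply_eq_sum]
  refine Finset.sum_congr rfl fun α _ => ?_
  rw [fderiv_apply hΦ α]
  rfl

/-- Composition law for the complex Laplacian. -/
theorem lapC_comp {f : (Fin n → ℂ) → ℂ} {Φ : (Fin m → ℂ) → (Fin n → ℂ)} {V : Set (Fin n → ℂ)}
    {U : Set (Fin m → ℂ)} (hV : IsOpen V) (hU : IsOpen U) (hf : DifferentiableOn ℂ f V)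
    (hΦ : DifferentiableOn ℂ Φ U) {p : Fin m → ℂ} (hp : p ∈ U ∩ Φ ⁻¹' V) :
    lapC (fun z => f (Φ z)) p =
      (∑ α, ∑ β, fderiv ℂ (fun w => fderiv ℂ f w (Pi.single α 1)) (Φ p) (Pi.single β 1) *
        innC (gradC (fun z => Φ z α) p) (gradC (fun z => Φ z β) p)) +
      ∑ α, fderiv ℂ f (Φ p) (Pi.single α 1) * lapC (fun z => Φ z α) p := by
  have hW : IsOpen (U ∩ Φ ⁻¹' V) := hΦ.continuousOn.isOpen_inter_preimage hU hV
  have hΦα : ∀ α, DifferentiableOn ℂ (fun z => Φ z α) U := differentiableOn_pi.mp hΦ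
  have hΦp := hΦ.differentiableAt (hU.mem_nhds hp.1)
  have hf1 : ∀ α, DifferentiableAt ℂ (fun w => fderiv ℂ f w (Pi.single α 1)) (Φ p) := fun α =>
    (hf.fderiv_apply_of_isOpen hV _).differentiableAt (hV.mem_nhds hp.2)
  have hf2 : ∀ α, DifferentiableAt ℂ (fun z => fderiv ℂ f (Φ z) (Pi.single α 1)) p := fun α =>
    (hf1 α).comp p hΦp
  have hΦ1 : ∀ α (k : Fin m),
      DifferentiableAt ℂ (fun z => fderiv ℂ (fun z => Φ z α) z (Pi.single k 1)) p := fun α k =>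
    ((hΦα α).fderiv_apply_of_isOpen hU _).differentiableAt (hU.mem_nhds hp.1)
  have key : ∀ k : Fin m,
      fderiv ℂ (fun z => fderiv ℂ (fun z => f (Φ z)) z (Pi.single k 1)) p (Pi.single k 1) =
        (∑ α, ∑ β, fderiv ℂ (fun w => fderiv ℂ f w (Pi.single α 1)) (Φ p) (Pi.single β 1) *
          (gradC (fun z => Φ z α) p k * gradC (fun z => Φ z β) p k)) +
        ∑ α, fderiv ℂ f (Φ p) (Pi.single α 1) *
          fderiv ℂ (fun z => fderiv ℂ (fun z => Φ z α) z (Pi.single k 1)) p (Pi.single k 1) := by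
    intro k
    have hev : (fun z => fderiv ℂ (fun z => f (Φ z)) z (Pi.single k 1)) =ᶠ[𝓝 p] fun z =>
        ∑ α, fderiv ℂ f (Φ z) (Pi.single α 1) *
          fderiv ℂ (fun z => Φ z α) z (Pi.single k 1) :=
      eventually_of_mem (hW.mem_nhds hp) fun z hz => fderiv_comp_apply_eq_sum
        (hf.differentiableAt (hV.mem_nhds hz.2)) (hΦ.differentiableAt (hU.mem_nhds hz.1)) _
    rw [hev.fderiv_eq, fderiv_fun_sum fun α _ => (hf2 α).fun_mul (hΦ1 α k), sum_apply,
      ← Finset.sum_add_distrib]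
    refine Finset.sum_congr rfl fun α _ => ?_
    rw [fderiv_fun_mul (hf2 α) (hΦ1 α k), add_apply, smul_apply, smul_apply,
      fderiv_comp_apply_eq_sum (hf1 α) hΦp, smul_eq_mul, smul_eq_mul, add_comm, Finset.mul_sum]
    congr 1
    refine Finset.sum_congr rfl fun β _ => ?_
    simp only [gradC]
    ring
  simp only [lapC, innC, key, Finset.sum_add_distrib, Finset.mul_sum]
  congr 1
  · rw [Finset.sum_comm]
    exact Finset.sum_congr rfl fun α _ => Finset.sum_comm
  · exact Finset.sum_comm

end Laplacian

/-- Fundamental characterization, flat case: a holomorphic map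
`Φ : U → ℂⁿ` on open `U ⊆ ℂ^m` is a complex-harmonic morphism iff it is
complex-harmonic and complex-horizontally weakly conformal: there is `Λ : U → ℂ` with
(a) `Δ_ℂ Φ_α = 0` and (b) `⟨grad_ℂ Φ_α, grad_ℂ Φ_β⟩_ℂ = δ_{αβ} Λ` on `U`. -/
theorem fundamental_characterization {m n : ℕ} (U : Set (Fin m → ℂ)) (hU : IsOpen U)
    (Φ : (Fin m → ℂ) → (Fin n → ℂ)) (hΦ : DifferentiableOn ℂ Φ U) :
    IsCHM Φ U ↔
      ∃ Λ : (Fin m → ℂ) → ℂ,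
        (∀ α : Fin n, ∀ p ∈ U, lapC (fun z => Φ z α) p = 0) ∧
        (∀ α β : Fin n, ∀ p ∈ U,
          innC (gradC (fun z => Φ z α) p) (gradC (fun z => Φ z β) p) =
            if α = β then Λ p else 0) := by
  have hΦα : ∀ α, DifferentiableOn ℂ (fun z => Φ z α) U := differentiableOn_pi.mp hΦ
  constructor
  · intro h
    have hpull : ∀ f : (Fin n → ℂ) → ℂ, ComplexHarmonicOn f univ →
        ∀ p ∈ U, lapC (fun z => f (Φ z)) p = 0 := fun f hf p hp =>
      (h univ isOpen_univ f hf ⟨p, hp, mem_univ _⟩).2 p ⟨hp, mem_univ _⟩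
    have hlap : ∀ α : Fin n, ∀ p ∈ U, lapC (fun z => Φ z α) p = 0 := fun α =>
      hpull _ (complexHarmonicOn_coord α)
    have hmul : ∀ α β : Fin n, ∀ p ∈ U, lapC (fun z => Φ z α * Φ z β) p =
        2 * innC (gradC (fun z => Φ z α) p) (gradC (fun z => Φ z β) p) := fun α β p hp => by
      rw [lapC_mul hU (hΦα α) (hΦα β) hp, hlap α p hp, hlap β p hp]
      ring
    have hoff : ∀ α β : Fin n, α ≠ β → ∀ p ∈ U,
        innC (gradC (fun z => Φ z α) p) (gradC (fun z => Φ z β) p) = 0 := fun α β hαβ p hp => by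
      have h1 := hpull _ (complexHarmonicOn_coord_mul hαβ) p hp
      rw [hmul α β p hp] at h1
      simpa using h1
    have hdiag : ∀ α β : Fin n, ∀ p ∈ U,
        innC (gradC (fun z => Φ z α) p) (gradC (fun z => Φ z α) p) =
          innC (gradC (fun z => Φ z β) p) (gradC (fun z => Φ z β) p) := fun α β p hp => by
      have h1 := hpull _ (complexHarmonicOn_coord_sq_sub α β) p hp
      rw [lapC_sub hU ((hΦα α).fun_mul (hΦα α)) ((hΦα β).fun_mul (hΦα β)) hp, hmul α α p hp,
        hmul β β p hp] at h1
      linear_combination h1 / 2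
    rcases isEmpty_or_nonempty (Fin n) with hn | ⟨⟨γ⟩⟩
    · exact ⟨0, hlap, fun α => hn.elim α⟩
    · refine ⟨fun p => innC (gradC (fun z => Φ z γ) p) (gradC (fun z => Φ z γ) p), hlap,
        fun α β p hp => ?_⟩
      split_ifs with hαβ
      · subst hαβ
        exact hdiag α γ p hp
      · exact hoff α β hαβ p hp
  · rintro ⟨Λ, hlap, hconf⟩ V hV f ⟨hf, hf0⟩ -
    refine ⟨hf.comp (hΦ.mono inter_subset_left) fun z hz => hz.2, fun p hp => ?_⟩
    have hcomp := lapC_comp hV hU hf hΦ hp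
    have hfp := hf0 (Φ p) hp.2
    simp only [lapC] at hfp
    simp only [hconf _ _ p hp.1, hlap _ p hp.1, mul_ite, mul_zero, Finset.sum_ite_eq,
      Finset.mem_univ, if_true, Finset.sum_const_zero, add_zero, ← Finset.sum_mul, hfp,
      zero_mul] at hcomp
    exact hcomp
end
end

section
/- Let Φ = Φ₁ + Φ₂i₂ : U → 𝔹 = ℂ² be a complex-harmonic morphism on an open set U ⊆ ℂ^m whose differential dΦ_p has complex rank at most one at every point p ∈ U. Then Φ is degenerate at every point where its differential is nonzero: for every p ∈ U with dΦ_p ≠ 0 one has (grad_ℂΦ₁)²(p) = (grad_ℂΦ₂)²(p) = 0 and ⟨grad_ℂΦ₁, grad_ℂΦ₂⟩_ℂ(p) = 0 (equivalently 𝒩(grad_ℂΦ)(p) = 0), i.e. p is a degenerate point of Φ. -/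
noncomputable section

/-- Complex (square) norm of a bicomplex number. -/
def bN (q : ℂ × ℂ) : ℂ := q.1 ^ 2 + q.2 ^ 2

/-- Complex Laplacian of `f : ℂ² → ℂ` (coordinates `q₁, q₂` on `𝔹 = ℂ²`). -/
def lapB (f : ℂ × ℂ → ℂ) (p : ℂ × ℂ) : ℂ :=
  fderiv ℂ (fun w => fderiv ℂ f w ((1 : ℂ), (0 : ℂ))) p ((1 : ℂ), (0 : ℂ)) +
  fderiv ℂ (fun w => fderiv ℂ f w ((0 : ℂ), (1 : ℂ))) p ((0 : ℂ), (1 : ℂ))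

/-- Complex-harmonic function on an open set `V ⊆ ℂ² = 𝔹`. -/
def ComplexHarmonicOnB (f : ℂ × ℂ → ℂ) (V : Set (ℂ × ℂ)) : Prop :=
  DifferentiableOn ℂ f V ∧ ∀ p ∈ V, lapB f p = 0

/-- Complex-harmonic morphism `ℂ^m ⊇ U → ℂ² = 𝔹`: pulls back complex-harmonic
functions on open subsets of `ℂ²` to complex-harmonic functions. -/
def IsCHMB {m : ℕ} (Φ : (Fin m → ℂ) → ℂ × ℂ) (U : Set (Fin m → ℂ)) : Prop :=
  ∀ V : Set (ℂ × ℂ), IsOpen V → ∀ f : ℂ × ℂ → ℂ,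
    ComplexHarmonicOnB f V → (U ∩ Φ ⁻¹' V).Nonempty →
      ComplexHarmonicOn (f ∘ Φ) (U ∩ Φ ⁻¹' V)

/-- The bicomplex gradient `grad_ℂ Φ ∈ 𝔹^m` of `Φ : ℂ^m → 𝔹`. -/
def gradB {m : ℕ} (Φ : (Fin m → ℂ) → ℂ × ℂ) (p : Fin m → ℂ) : Fin m → ℂ × ℂ :=
  fun k => (fderiv ℂ (fun z => (Φ z).1) p (Pi.single k 1),
            fderiv ℂ (fun z => (Φ z).2) p (Pi.single k 1))

open Metric Set Filter Topology in
/-- Directional derivatives of a holomorphic function on an open subset of a finite-dimensional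
complex space are differentiable. -/
theorem differentiableAt_fderiv_apply {E : Type*} [NormedAddCommGroup E] [NormedSpace ℂ E]
    [FiniteDimensional ℂ E] {U : Set E} (hU : IsOpen U) {g : E → ℂ}
    (hg : DifferentiableOn ℂ g U) {p : E} (hp : p ∈ U) (v : E) :
    DifferentiableAt ℂ (fun z => fderiv ℂ g z v) p := by
  borelize E
  have : ProperSpace (E →L[ℂ] ℂ) := FiniteDimensional.proper ℂ _
  obtain ⟨ε, hε, hball⟩ : ∃ ε > 0, ∀ z ∈ ball p ε, z ∈ U ∧ g z ∈ ball (g p) 1 := by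
    have h1 : ∀ᶠ z in 𝓝 p, z ∈ U ∧ g z ∈ ball (g p) 1 :=
      Filter.Eventually.and (hU.mem_nhds hp) ((hg.differentiableAt (hU.mem_nhds hp)).continuousAt.eventually
        (ball_mem_nhds _ one_pos))
    exact Metric.eventually_nhds_iff_ball.1 h1
  have hfd : ∀ w ∈ ball p (ε / 2), ‖fderiv ℂ g w‖ ≤ 2 / (ε / 2) := by
    intro w hw
    have hsub : ball w (ε / 2) ⊆ ball p ε :=
      ball_subset_ball' (by linarith [mem_ball.1 hw])
    refine Complex.norm_fderiv_le_div_of_mapsTo_ball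
      (hg.mono fun z hz => (hball z (hsub hz)).1) (fun z hz => ?_) (half_pos hε)
    have h1 := mem_ball.1 (hball z (hsub hz)).2
    have h2 := mem_ball'.1 (hball w (ball_subset_ball (by linarith) hw)).2
    exact mem_closedBall.2 ((dist_triangle _ (g p) _).trans (by linarith))
  set r : ℝ := ε / 4 / (‖v‖ + 1) with hr_def
  have hv : 0 < ‖v‖ + 1 := by positivity
  have hr : 0 < r := by positivity
  have hmem : ∀ z ∈ ball p (ε / 4), ∀ t ∈ closedBall (0 : ℂ) r, z + t • v ∈ ball p (ε / 2) := by
    intro z hz t ht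
    have h1 : ‖t • v‖ ≤ ε / 4 := by
      rw [norm_smul]
      calc ‖t‖ * ‖v‖ ≤ r * (‖v‖ + 1) := by
            gcongr
            · simpa using ht
            · linarith
        _ = ε / 4 := div_mul_cancel₀ _ hv.ne'
    rw [mem_ball, dist_eq_norm] at hz ⊢
    calc ‖z + t • v - p‖ = ‖(z - p) + t • v‖ := by congr 1; abel
      _ ≤ ‖z - p‖ + ‖t • v‖ := norm_add_le _ _
      _ < ε / 2 := by linarith
  have hhalf : ball p (ε / 2) ⊆ U := fun z hz => (hball z (ball_subset_ball (by linarith) hz)).1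
  have hline : ∀ z : E, Continuous fun t : ℂ => z + t • v := fun z => by fun_prop
  have hcauchy : ∀ z ∈ ball p (ε / 4),
      Complex.cderiv r (fun t : ℂ => g (z + t • v)) 0 = fderiv ℂ g z v := by
    intro z hz
    rw [Complex.cderiv_eq_deriv (hU.preimage (hline z)) ?_ hr
      (fun t ht => hhalf (hmem z hz t ht))]
    · have hzU : z + (0 : ℂ) • v ∈ U := hhalf (hmem z hz 0 (mem_closedBall_self hr.le))
      have h1 : HasDerivAt (fun t : ℂ => z + t • v) v 0 := by
        simpa using ((hasDerivAt_id (0 : ℂ)).smul_const v).const_add z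
      have h2 := (hg.differentiableAt (hU.mem_nhds hzU)).hasFDerivAt.comp_hasDerivAt (0 : ℂ) h1
      simpa [Function.comp_def] using h2.deriv
    · exact hg.comp (by fun_prop) fun t ht => ht
  set c : ℝ → ℂ := fun θ => deriv (circleMap 0 r) θ * ((circleMap 0 r θ - 0) ^ 2)⁻¹ with hc
  have hcirc : ∀ θ, circleMap 0 r θ ∈ closedBall (0 : ℂ) r := fun θ =>
    circleMap_mem_closedBall 0 hr.le θ
  have hc_cont : Continuous c := by
    have h0 : ∀ θ, (circleMap 0 r θ - 0) ^ 2 ≠ 0 := fun θ => by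
      simpa using hr.ne'
    simp only [hc, deriv_circleMap]
    exact (by fun_prop : Continuous fun θ => circleMap 0 r θ * Complex.I).mul
      (Continuous.inv₀ (by fun_prop) h0)
  have hF_cont : ∀ z ∈ ball p (ε / 4),
      Continuous fun θ => c θ • g (z + circleMap 0 r θ • v) := fun z hz =>
    hc_cont.smul (hg.continuousOn.comp_continuous (by fun_prop)
      fun θ => hhalf (hmem z hz _ (hcirc θ)))
  have hnhds : ball p (ε / 4) ∈ 𝓝 p := ball_mem_nhds _ (by positivity)
  have key := intervalIntegral.hasFDerivAt_integral_of_dominated_of_fderiv_le (𝕜 := ℂ)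
    (μ := MeasureTheory.volume) (a := 0) (b := 2 * Real.pi)
    (F := fun z θ => c θ • g (z + circleMap 0 r θ • v))
    (F' := fun z θ => c θ • fderiv ℂ g (z + circleMap 0 r θ • v))
    (bound := fun θ => ‖c θ‖ * (2 / (ε / 2)))
    (x₀ := p) hnhds
    (by
      filter_upwards [hnhds] with z hz
      exact (hF_cont z hz).aestronglyMeasurable)
    ((hF_cont p (mem_ball_self (by positivity))).intervalIntegrable _ _)
    (by
      refine hc_cont.aestronglyMeasurable.smul (Measurable.aestronglyMeasurable ?_)
      exact (measurable_fderiv ℂ g).comp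
        (by fun_prop : Continuous fun θ => p + circleMap 0 r θ • v).measurable)
    (.of_forall fun θ _ z hz => by
      rw [norm_smul]
      gcongr
      exact hfd _ (hmem z hz _ (hcirc θ)))
    ((hc_cont.norm.mul continuous_const).intervalIntegrable _ _)
    (.of_forall fun θ _ z hz => by
      have h1 := (hg.differentiableAt
        (hU.mem_nhds (hhalf (hmem z hz _ (hcirc θ))))).hasFDerivAt
      exact ((hasFDerivAt_comp_add_right _).2 h1).const_smul (c θ))
  refine (key.differentiableAt.const_smul (2 * Real.pi * Complex.I : ℂ)⁻¹).congr_of_eventuallyEq ?_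
  filter_upwards [hnhds] with z hz
  rw [← hcauchy z hz]
  simp [Complex.cderiv, circleIntegral, hc, mul_assoc]

/-- If a holomorphic function and its square are both complex-harmonic, then its complex gradient
is isotropic. -/
theorem innC_gradC_self_eq_zero {m : ℕ} {U : Set (Fin m → ℂ)} (hU : IsOpen U)
    {g : (Fin m → ℂ) → ℂ} (hg : ComplexHarmonicOn g U)
    (hg2 : ComplexHarmonicOn (fun z => g z ^ 2) U) {p : Fin m → ℂ} (hp : p ∈ U) :
    innC (gradC g p) (gradC g p) = 0 := by
  have hterm : ∀ v, fderiv ℂ (fun z => fderiv ℂ (fun w => g w ^ 2) z v) p v =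
      2 * (fderiv ℂ g p v * fderiv ℂ g p v) +
        2 * g p * fderiv ℂ (fun z => fderiv ℂ g z v) p v := by
    intro v
    have hev : (fun z => fderiv ℂ (fun w => g w ^ 2) z v) =ᶠ[nhds p]
        fun z => 2 * g z * fderiv ℂ g z v := by
      filter_upwards [hU.mem_nhds hp] with z hz
      have h1 := ((hg.1.differentiableAt (hU.mem_nhds hz)).hasFDerivAt.pow 2).fderiv
      rw [h1]
      simp
    have h1 := (hg.1.differentiableAt (hU.mem_nhds hp)).hasFDerivAt.const_mul (2 : ℂ)
    have h2 := (differentiableAt_fderiv_apply hU hg.1 hp v).hasFDerivAt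
    have h3 : fderiv ℂ (fun z => 2 * g z * fderiv ℂ g z v) p = _ := (h1.mul h2).fderiv
    rw [hev.fderiv_eq, h3]
    simp only [add_apply, smul_apply, smul_eq_mul]
    ring
  have h1 := hg.2 p hp
  have h2 := hg2.2 p hp
  simp only [lapC] at h1 h2
  simp only [hterm, Finset.sum_add_distrib, ← Finset.mul_sum, h1, mul_zero, add_zero] at h2
  simpa [innC, gradC] using h2

/-- Powers one and two of the isotropic linear form `q₁ + c q₂`, `c² = -1`, are
complex-harmonic. -/
theorem complexHarmonicOnB_isotropic {c : ℂ} (hc : c ^ 2 = -1) :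
    ComplexHarmonicOnB (fun q => q.1 + c * q.2) Set.univ ∧
      ComplexHarmonicOnB (fun q => (q.1 + c * q.2) ^ 2) Set.univ := by
  set L : ℂ × ℂ →L[ℂ] ℂ :=
    ContinuousLinearMap.fst ℂ ℂ ℂ + c • ContinuousLinearMap.snd ℂ ℂ ℂ with hL
  have hL1 : (fun q : ℂ × ℂ => q.1 + c * q.2) = L := by ext q; simp [hL]
  have hL2 : (fun q : ℂ × ℂ => (q.1 + c * q.2) ^ 2) = fun q => L q ^ 2 := by ext q; simp [hL]
  have hd : ∀ v w, fderiv ℂ (fun q => L q ^ 2) w v = 2 * L v * L w := by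
    intro v w
    rw [(L.hasFDerivAt.pow 2).fderiv]
    simp
    ring
  have hdd : ∀ v p, fderiv ℂ (fun w => 2 * L v * L w) p v = 2 * L v * L v := by
    intro v p
    rw [(L.hasFDerivAt.const_mul (2 * L v)).fderiv]
    simp
  refine ⟨⟨by fun_prop, fun p _ => ?_⟩, by fun_prop, fun p _ => ?_⟩
  · simp [lapB, hL1]
  · rw [hL2]
    simp only [lapB, hd, hdd]
    simp only [hL, add_apply, smul_apply,
      ContinuousLinearMap.coe_fst', ContinuousLinearMap.coe_snd', smul_eq_mul]
    linear_combination 2 * hc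

/-- Isotropy of the gradient of `Φ₁ + c Φ₂`, `c² = -1`, for a complex-harmonic morphism, in terms of
the gradients of the components. -/
theorem IsCHMB.isotropic {m : ℕ} {U : Set (Fin m → ℂ)} (hU : IsOpen U)
    {Φ : (Fin m → ℂ) → ℂ × ℂ} (hΦ : DifferentiableOn ℂ Φ U) (hCHM : IsCHMB Φ U)
    {p : Fin m → ℂ} (hp : p ∈ U) {c : ℂ} (hc : c ^ 2 = -1) :
    ∑ k, ((fderiv ℂ Φ p (Pi.single k 1)).1 + c * (fderiv ℂ Φ p (Pi.single k 1)).2) ^ 2 = 0 := by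
  obtain ⟨h1, h2⟩ := complexHarmonicOnB_isotropic hc
  have hne : (U ∩ Φ ⁻¹' Set.univ).Nonempty := ⟨p, hp, trivial⟩
  have g1 := hCHM _ isOpen_univ _ h1 hne
  have g2 := hCHM _ isOpen_univ _ h2 hne
  simp only [Set.preimage_univ, Set.inter_univ] at g1 g2
  have key := innC_gradC_self_eq_zero hU g1 g2 hp
  have hd := (hΦ.differentiableAt (hU.mem_nhds hp)).hasFDerivAt
  have hf := (hd.fst.add (hd.snd.const_mul c)).fderiv
  have hf' : fderiv ℂ ((fun q : ℂ × ℂ => q.1 + c * q.2) ∘ Φ) p = _ := hf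
  simpa [innC, gradC, hf', sq] using key

/-- a complex-harmonic morphism `Φ : U → 𝔹 = ℂ²` whose differential has
complex rank at most one everywhere is degenerate at every point where its
differential is nonzero: there `(grad_ℂ Φ₁)² = (grad_ℂ Φ₂)² = 0`,
`⟨grad_ℂ Φ₁, grad_ℂ Φ₂⟩_ℂ = 0`, equivalently `𝒩(grad_ℂ Φ) = 0`. -/
theorem rank_le_one_chm_degenerate {m : ℕ} (U : Set (Fin m → ℂ)) (hU : IsOpen U)
    (Φ : (Fin m → ℂ) → ℂ × ℂ) (hΦ : DifferentiableOn ℂ Φ U)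
    (hCHM : IsCHMB Φ U)
    (hrank : ∀ p ∈ U,
      LinearMap.rank ((fderiv ℂ Φ p : (Fin m → ℂ) →L[ℂ] ℂ × ℂ) :
        (Fin m → ℂ) →ₗ[ℂ] ℂ × ℂ) ≤ 1)
    (p : Fin m → ℂ) (hp : p ∈ U) (hne : fderiv ℂ Φ p ≠ 0) :
    innC (gradC (fun z => (Φ z).1) p) (gradC (fun z => (Φ z).1) p) = 0 ∧
    innC (gradC (fun z => (Φ z).2) p) (gradC (fun z => (Φ z).2) p) = 0 ∧
    innC (gradC (fun z => (Φ z).1) p) (gradC (fun z => (Φ z).2) p) = 0 ∧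
    ∑ k, bN (gradB Φ p k) = 0 := by
  have hd := (hΦ.differentiableAt (hU.mem_nhds hp)).hasFDerivAt
  have hf1 := hd.fst.fderiv
  have hf2 := hd.snd.fderiv
  obtain ⟨w, hw⟩ := (rank_submodule_le_one_iff' _).1 (hrank p hp)
  have hr : ∀ k : Fin m, ∃ r : ℂ, r • w = fderiv ℂ Φ p (Pi.single k 1) := fun k =>
    Submodule.mem_span_singleton.1 (hw ⟨Pi.single k 1, rfl⟩)
  choose r hr using hr
  have hiso : ∀ c : ℂ, c ^ 2 = -1 → (∑ k, r k ^ 2) * (w.1 + c * w.2) ^ 2 = 0 := by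
    intro c hc
    rw [← hCHM.isotropic hU hΦ hp hc, Finset.sum_mul]
    refine Finset.sum_congr rfl fun k _ => ?_
    rw [← hr k]
    simp only [Prod.smul_fst, Prod.smul_snd, smul_eq_mul]
    ring
  have hzero : (∑ k, r k ^ 2) * w.1 ^ 2 = 0 ∧ (∑ k, r k ^ 2) * w.2 ^ 2 = 0 ∧
      (∑ k, r k ^ 2) * (w.1 * w.2) = 0 := by
    have hI := hiso Complex.I Complex.I_sq
    have hI' := hiso (-Complex.I) (by simp)
    rcases mul_eq_zero.1 hI with h | h
    · simp [h]
    rcases mul_eq_zero.1 hI' with h' | h'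
    · simp [h']
    have h1 := pow_eq_zero_iff two_ne_zero |>.1 h
    have h2 := pow_eq_zero_iff two_ne_zero |>.1 h'
    have hw1 : w.1 = 0 := by linear_combination (h1 + h2) / 2
    have hw2 : w.2 = 0 := by simpa [hw1] using h1
    simp [hw1, hw2]
  obtain ⟨h11, h22, h12⟩ := hzero
  have hsum : ∀ a b : ℂ, ∑ k, r k * a * (r k * b) = (∑ k, r k ^ 2) * (a * b) := by
    intro a b
    rw [Finset.sum_mul]
    exact Finset.sum_congr rfl fun k _ => by ring
  rw [sq] at h11 h22
  refine ⟨?_, ?_, ?_, ?_⟩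
  · simp [innC, gradC, hf1, ← hr, hsum, -mul_eq_zero, h11]
  · simp [innC, gradC, hf2, ← hr, hsum, -mul_eq_zero, h22]
  · simp [innC, gradC, hf1, hf2, ← hr, hsum, -mul_eq_zero, h12]
  · simp [bN, gradB, hf1, hf2, ← hr, pow_two (r _ * _), Finset.sum_add_distrib, hsum, -mul_eq_zero, h11, h22]
end
end

section
/- Let N ⊆ ℂ² (identified with 𝔹) be open and let ξ = (ξ₁, ξ₂, ξ₃) : N → 𝔹³ be a bicomplex-holomorphic map which is null, i.e. ξ(q)² = ξ₁(q)² + ξ₂(q)² + ξ₃(q)² = 0 for all q ∈ N, and suppose 𝒩(ξ) is not identically zero on N. Then any C² map Φ : U → N on an open set U ⊆ ℂ³ satisfying ⟨ξ(Φ(z)), z⟩_𝔹 = 1 for all z ∈ U is a complex-harmonic morphism whose differential has complex rank at least one at every point; moreover Φ is degenerate exactly at the points z ∈ U with 𝒩(ξ(Φ(z))) = 0. -/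
noncomputable section

open Metric Topology in
/-- Directional derivatives of a holomorphic function on an open subset of a finite-dimensional
complex space are holomorphic. -/
theorem DifferentiableOn.fderiv_apply_complex {E : Type*} [NormedAddCommGroup E]
    [NormedSpace ℂ E] [FiniteDimensional ℂ E] {f : E → ℂ} {V : Set E}
    (hf : DifferentiableOn ℂ f V) (hV : IsOpen V) (v : E) :
    DifferentiableOn ℂ (fun x => fderiv ℂ f x v) V := by
  let : MeasurableSpace E := borel E
  have : BorelSpace E := ⟨rfl⟩
  have : ProperSpace E := FiniteDimensional.proper ℂ E
  intro x₀ hx₀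
  obtain ⟨r, hr, hrV, hrf⟩ : ∃ r > 0, ball x₀ r ⊆ V ∧ Set.MapsTo f (ball x₀ r) (ball (f x₀) 1) := by
    have h1 := (hf.differentiableAt (hV.mem_nhds hx₀)).continuousAt.preimage_mem_nhds
      (ball_mem_nhds (f x₀) one_pos)
    obtain ⟨r, hr, h⟩ := Metric.mem_nhds_iff.1 (Filter.inter_mem (hV.mem_nhds hx₀) h1)
    exact ⟨r, hr, fun x hx => (h hx).1, fun x hx => (h hx).2⟩
  have hfd : ∀ x ∈ ball x₀ r, DifferentiableAt ℂ f x := fun x hx =>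
    hf.differentiableAt (hV.mem_nhds (hrV hx))
  have hbound : ∀ x ∈ ball x₀ (r / 2), ‖fderiv ℂ f x‖ ≤ 2 / (r / 2) := by
    intro x hx
    have hsub : ball x (r / 2) ⊆ ball x₀ r := ball_subset_ball' (by
      have := mem_ball.1 hx
      linarith)
    refine Complex.norm_fderiv_le_div_of_mapsTo_ball (hf.mono (hsub.trans hrV)) ?_ (half_pos hr)
    intro y hy
    have h1 := mem_ball.1 (hrf (hsub hy))
    have h2 := mem_ball'.1 (hrf (hsub (mem_ball_self (half_pos hr))))
    have := dist_triangle (f y) (f x₀) (f x)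
    rw [mem_closedBall]
    linarith
  obtain ⟨R, hR, hRv⟩ : ∃ R > 0, R * ‖v‖ < r / 4 := by
    refine ⟨r / 4 / (‖v‖ + 1), by positivity, ?_⟩
    rw [div_mul_eq_mul_div, div_lt_iff₀ (by positivity)]
    nlinarith [norm_nonneg v]
  have hmem : ∀ x ∈ ball x₀ (r / 4), ∀ z : ℂ, ‖z‖ ≤ R → x + z • v ∈ ball x₀ (r / 2) := by
    intro x hx z hz
    rw [mem_ball, dist_eq_norm] at hx ⊢
    have h1 : ‖z • v‖ ≤ R * ‖v‖ := by
      rw [norm_smul]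
      gcongr
    have h2 := norm_add_le (x - x₀) (z • v)
    rw [show x + z • v - x₀ = x - x₀ + z • v by abel]
    linarith
  have hhalf : ball x₀ (r / 2) ⊆ ball x₀ r := ball_subset_ball (by linarith)
  have hc : ∀ θ, ‖circleMap 0 R θ‖ ≤ R := fun θ => by simp [abs_of_pos hR]
  have hc0 : ∀ θ, circleMap 0 R θ ≠ 0 := fun θ => circleMap_ne_center hR.ne'
  set k : ℝ → ℂ := fun θ => _root_.deriv (circleMap 0 R) θ * (1 / (circleMap 0 R θ - 0) ^ 2) with hk
  have hkc : Continuous k := by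
    simp only [hk, deriv_circleMap, sub_zero]
    exact ((continuous_circleMap 0 R).mul continuous_const).mul
      (continuous_const.div ((continuous_circleMap 0 R).pow 2) fun θ => pow_ne_zero 2 (hc0 θ))
  have hcauchy : ∀ x ∈ ball x₀ (r / 4), fderiv ℂ f x v =
      (2 * Real.pi * Complex.I)⁻¹ *
        ∫ θ in (0 : ℝ)..2 * Real.pi, k θ • f (x + circleMap 0 R θ • v) := by
    intro x hx
    have hline : ∀ z : ℂ, ‖z‖ ≤ R →
        HasDerivAt (fun z : ℂ => f (x + z • v)) (fderiv ℂ f (x + z • v) v) z := by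
      intro z hz
      have h1 : HasDerivAt (fun z : ℂ => x + z • v) v z := by
        simpa using ((hasDerivAt_id z).smul_const v).const_add x
      exact (hfd _ (hhalf (hmem x hx z hz))).hasFDerivAt.comp_hasDerivAt z h1
    have hd : DifferentiableOn ℂ (fun z : ℂ => f (x + z • v)) (closedBall 0 R) := fun z hz =>
      (hline z (by simpa using hz)).differentiableAt.differentiableWithinAt
    have h2 := hd.deriv_eq_smul_circleIntegral hR
    rw [(hline 0 (by simpa using hR.le)).deriv, circleIntegral] at h2
    simp only [zero_smul, add_zero] at h2
    rw [eq_inv_mul_iff_mul_eq₀ Complex.two_pi_I_ne_zero, ← smul_eq_mul, ← h2]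
    simp only [hk, smul_eq_mul, mul_assoc]
  have hshift : Continuous fun θ : ℝ => x₀ + circleMap 0 R θ • v :=
    continuous_const.add ((continuous_circleMap 0 R).smul continuous_const)
  have hcont : ∀ x ∈ ball x₀ (r / 4),
      Continuous fun θ : ℝ => k θ • f (x + circleMap 0 R θ • v) := by
    intro x hx
    refine hkc.smul (continuous_iff_continuousAt.2 fun θ => ?_)
    exact (hfd _ (hhalf (hmem x hx _ (hc θ)))).continuousAt.comp
      (f := fun θ : ℝ => x + circleMap 0 R θ • v)
      (continuous_const.add ((continuous_circleMap 0 R).smul continuous_const)).continuousAt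
  have hr4 : ball x₀ (r / 4) ∈ 𝓝 x₀ := ball_mem_nhds _ (by linarith)
  have key := intervalIntegral.hasFDerivAt_integral_of_dominated_of_fderiv_le (𝕜 := ℂ)
    (μ := MeasureTheory.volume) (a := 0) (b := 2 * Real.pi)
    (F := fun x θ => k θ • f (x + circleMap 0 R θ • v))
    (F' := fun x θ => k θ • fderiv ℂ f (x + circleMap 0 R θ • v))
    (bound := fun θ => ‖k θ‖ * (2 / (r / 2))) hr4
    (Filter.mem_of_superset hr4 fun x hx => (hcont x hx).aestronglyMeasurable)
    ((hcont x₀ (mem_of_mem_nhds hr4)).intervalIntegrable _ _)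
    ((hkc.measurable.smul ((measurable_fderiv ℂ f).comp hshift.measurable)).aestronglyMeasurable)
    (Filter.Eventually.of_forall fun θ _ x hx => by
      rw [norm_smul]
      exact mul_le_mul_of_nonneg_left (hbound _ (hmem x hx _ (hc θ))) (norm_nonneg _))
    ((hkc.norm.mul continuous_const).intervalIntegrable _ _)
    (Filter.Eventually.of_forall fun θ _ x hx =>
      ((hasFDerivAt_comp_add_right _).2
        (hfd _ (hhalf (hmem x hx _ (hc θ)))).hasFDerivAt).const_smul (k θ))
  refine (DifferentiableAt.congr_of_eventuallyEq (key.differentiableAt.const_mul _)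
    (Filter.mem_of_superset hr4 hcauchy)).differentiableWithinAt

/-- If the derivative of `f` is everywhere a multiple `g • L` of a fixed functional `L`, then the
derivative of the coefficient `g` is again a multiple of `L`. -/
theorem hasFDerivAt_coeff_of_fderiv_eq_smul {B : Type*} [NormedAddCommGroup B]
    [NormedSpace ℂ B] [FiniteDimensional ℂ B] {f g : B → ℂ} {N : Set B} (hN : IsOpen N)
    (L : B →L[ℂ] ℂ) {w : B} (hw : L w = 1)
    (hf : ∀ q ∈ N, HasFDerivAt f (g q • L) q) {q : B} (hq : q ∈ N) :
    HasFDerivAt g (fderiv ℂ g q w • L) q := by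
  have hd : DifferentiableOn ℂ f N := fun q hq => (hf q hq).differentiableAt.differentiableWithinAt
  have hg : Set.EqOn g (fun q => fderiv ℂ f q w) N := fun q hq => by simp [(hf q hq).fderiv, hw]
  have hgd : DifferentiableAt ℂ g q :=
    ((hd.fderiv_apply_complex hN w).congr hg).differentiableAt (hN.mem_nhds hq)
  have hfg : HasFDerivAt (fun q => g q • L) ((fderiv ℂ g q).smulRight L) q :=
    hgd.hasFDerivAt.smul_const L
  convert hgd.hasFDerivAt using 1
  ext v
  simpa [hw] using second_derivative_symmetric_of_eventually (𝕜 := ℂ)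
    (Filter.mem_of_superset (hN.mem_nhds hq) hf) hfg w v

/-- Implicit differentiation of `∑ k, α k (Φ z) * z k = 1`, where `dα k = g k • L`: the composition
`L ∘ Φ` is holomorphic with gradient proportional to `α ∘ Φ`. -/
theorem implicit_first_order {m : ℕ} {B : Type*} [NormedAddCommGroup B] [NormedSpace ℂ B]
    (L : B →L[ℂ] ℂ) {N : Set B} {α g : Fin m → B → ℂ}
    (hα : ∀ k, ∀ q ∈ N, HasFDerivAt (α k) (g k q • L) q)
    {U : Set (Fin m → ℂ)} (hU : IsOpen U) {Φ : (Fin m → ℂ) → B}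
    (hΦ : DifferentiableOn ℝ Φ U) (hmem : ∀ z ∈ U, Φ z ∈ N)
    (heq : ∀ z ∈ U, ∑ k, α k (Φ z) * z k = 1) {z : Fin m → ℂ} (hz : z ∈ U) :
    DifferentiableAt ℂ (fun z => L (Φ z)) z ∧ ∑ j, g j (Φ z) * z j ≠ 0 ∧
      ∀ k, fderiv ℂ (fun z => L (Φ z)) z (Pi.single k 1) * ∑ j, g j (Φ z) * z j =
        -α k (Φ z) := by
  have hΦ' := (hΦ.differentiableAt (hU.mem_nhds hz)).hasFDerivAt
  set Φ' := fderiv ℝ Φ z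
  have hLΦ : HasFDerivAt (fun z => L (Φ z)) ((L.restrictScalars ℝ).comp Φ') z :=
    (L.restrictScalars ℝ).hasFDerivAt.comp z hΦ'
  have hαΦ : ∀ k, HasFDerivAt (fun z => α k (Φ z))
      (((g k (Φ z) • L).restrictScalars ℝ).comp Φ') z := fun k =>
    ((hα k _ (hmem z hz)).restrictScalars ℝ).comp z hΦ'
  have hproj : ∀ k, HasFDerivAt (fun z : Fin m → ℂ => z k)
      (ContinuousLinearMap.proj (R := ℝ) (φ := fun _ => ℂ) k) z := fun k =>
    (ContinuousLinearMap.proj (R := ℝ) (φ := fun _ : Fin m => ℂ) k).hasFDerivAt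
  have hsum := HasFDerivAt.fun_sum (u := Finset.univ) fun k _ => (hαΦ k).mul (hproj k)
  have hconst : HasFDerivAt (fun z => ∑ k, α k (Φ z) * z k)
      (0 : (Fin m → ℂ) →L[ℝ] ℂ) z :=
    (hasFDerivAt_const (1 : ℂ) z).congr_of_eventuallyEq
      (Filter.mem_of_superset (hU.mem_nhds hz) heq)
  have hlin : ∀ v : Fin m → ℂ,
      ∑ k, α k (Φ z) * v k + L (Φ' v) * ∑ j, g j (Φ z) * z j = 0 := by
    intro v
    have h := congrArg (fun T : (Fin m → ℂ) →L[ℝ] ℂ => T v) (hsum.unique hconst)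
    simp only [sum_apply, add_apply,
      smul_apply, ContinuousLinearMap.proj_apply,
      ContinuousLinearMap.comp_apply, ContinuousLinearMap.coe_restrictScalars', smul_eq_mul,
      Finset.sum_add_distrib, zero_apply] at h
    rw [← h, Finset.mul_sum]
    congr 1
    exact Finset.sum_congr rfl fun k _ => by ring
  have hA : ∑ j, g j (Φ z) * z j ≠ 0 := by
    intro h0
    have h := hlin z
    rw [heq z hz, h0] at h
    simp at h
  set A := ∑ j, g j (Φ z) * z j
  let T : (Fin m → ℂ) →L[ℂ] ℂ :=
    (-A⁻¹) • ∑ k, α k (Φ z) • ContinuousLinearMap.proj (R := ℂ) (φ := fun _ => ℂ) k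
  have hT : HasFDerivAt (fun z => L (Φ z)) T z := by
    refine hasFDerivAt_of_restrictScalars ℝ hLΦ ?_
    ext v
    have h : L (Φ' v) = -A⁻¹ * ∑ k, α k (Φ z) * v k := by
      have := hlin v
      field_simp
      linear_combination this
    simp [T, h]
  refine ⟨hT.differentiableAt, hA, fun k => ?_⟩
  rw [hT.fderiv]
  have h : T (Pi.single k 1) = -A⁻¹ * α k (Φ z) := by simp [T, Pi.single_apply]
  rw [h]
  field_simp

/-- The derivative of the nullity relation `∑ k, α k ^ 2 = 0` when `dα k = g k • L`. -/
theorem sum_mul_coeff_eq_zero_of_null {m : ℕ} {B : Type*} [NormedAddCommGroup B] [NormedSpace ℂ B]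
    (L : B →L[ℂ] ℂ) {w : B} (hw : L w = 1) {N : Set B} (hN : IsOpen N) {α g : Fin m → B → ℂ}
    (hα : ∀ k, ∀ q ∈ N, HasFDerivAt (α k) (g k q • L) q)
    (hnull : ∀ q ∈ N, ∑ k, α k q * α k q = 0) {q : B} (hq : q ∈ N) :
    ∑ k, α k q * g k q = 0 := by
  have h1 := HasFDerivAt.fun_sum (u := Finset.univ) fun k _ => (hα k q hq).mul (hα k q hq)
  have h2 : HasFDerivAt (fun q => ∑ k, α k q * α k q) (0 : B →L[ℂ] ℂ) q :=
    (hasFDerivAt_const (0 : ℂ) q).congr_of_eventuallyEq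
      (Filter.mem_of_superset (hN.mem_nhds hq) hnull)
  have h := congrArg (fun T : B →L[ℂ] ℂ => T w) (h1.unique h2)
  simp [hw, Finset.sum_add_distrib] at h
  exact h

/-- If `dα k = g k • L` with `α` null, a holomorphic solution `Φ` of `∑ k, α k (Φ z) * z k = 1` has
complex-harmonic composition `L ∘ Φ`. -/
theorem implicit_lapC_eq_zero {m : ℕ} {B : Type*} [NormedAddCommGroup B] [NormedSpace ℂ B]
    [FiniteDimensional ℂ B]
    (L : B →L[ℂ] ℂ) {w : B} (hw : L w = 1) {N : Set B} (hN : IsOpen N) {α g : Fin m → B → ℂ}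
    (hα : ∀ k, ∀ q ∈ N, HasFDerivAt (α k) (g k q • L) q)
    (hnull : ∀ q ∈ N, ∑ k, α k q * α k q = 0)
    {U : Set (Fin m → ℂ)} (hU : IsOpen U) {Φ : (Fin m → ℂ) → B}
    (hΦ : DifferentiableOn ℂ Φ U) (hmem : ∀ z ∈ U, Φ z ∈ N)
    (heq : ∀ z ∈ U, ∑ k, α k (Φ z) * z k = 1) {z : Fin m → ℂ} (hz : z ∈ U) :
    lapC (fun z => L (Φ z)) z = 0 := by
  set a := fun z => L (Φ z)
  have hfirst := fun z (hz : z ∈ U) =>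
    implicit_first_order L hα hU (hΦ.restrictScalars ℝ) hmem heq hz
  obtain ⟨-, hA, hak⟩ := hfirst z hz
  set A := ∑ j, g j (Φ z) * z j with hAdef
  have haU : DifferentiableOn ℂ a U := fun z hz => (hfirst z hz).1.differentiableWithinAt
  have hΦ' := (hΦ.differentiableAt (hU.mem_nhds hz)).hasFDerivAt
  have ha' : ∀ v, L (fderiv ℂ Φ z v) = fderiv ℂ a z v := fun v => by
    rw [(show HasFDerivAt a (L.comp (fderiv ℂ Φ z)) z from L.hasFDerivAt.comp z hΦ').fderiv]
    rfl
  have hdiff : ∀ k, HasFDerivAt (fun z => fderiv ℂ a z (Pi.single k 1))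
      (fderiv ℂ (fun z => fderiv ℂ a z (Pi.single k 1)) z) z := fun k =>
    ((haU.fderiv_apply_complex hU _).differentiableAt (hU.mem_nhds hz)).hasFDerivAt
  have hαΦ : ∀ k, HasFDerivAt (fun z => α k (Φ z)) ((g k (Φ z) • L).comp (fderiv ℂ Φ z)) z :=
    fun k => (hα k _ (hmem z hz)).comp z hΦ'
  have hgΦ : ∀ k, HasFDerivAt (fun z => g k (Φ z))
      ((fderiv ℂ (g k) (Φ z) w • L).comp (fderiv ℂ Φ z)) z := fun k =>
    (hasFDerivAt_coeff_of_fderiv_eq_smul hN L hw (hα k) (hmem z hz)).comp z hΦ'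
  have hproj : ∀ k, HasFDerivAt (fun z : Fin m → ℂ => z k)
      (ContinuousLinearMap.proj (R := ℂ) (φ := fun _ => ℂ) k) z := fun k =>
    (ContinuousLinearMap.proj (R := ℂ) (φ := fun _ : Fin m => ℂ) k).hasFDerivAt
  have hAd := HasFDerivAt.fun_sum (u := Finset.univ) fun k _ => (hgΦ k).mul (hproj k)
  set S := ∑ j, fderiv ℂ (g j) (Φ z) w * z j with hS
  have hsecond : ∀ k, fderiv ℂ (fun z => fderiv ℂ a z (Pi.single k 1)) z (Pi.single k 1) * A =
      -(2 * (g k (Φ z) * fderiv ℂ a z (Pi.single k 1)) +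
        S * (fderiv ℂ a z (Pi.single k 1) * fderiv ℂ a z (Pi.single k 1))) := by
    intro k
    have h1 := (hdiff k).mul hAd
    have h2 := (hαΦ k).neg.congr_of_eventuallyEq
      (Filter.mem_of_superset (hU.mem_nhds hz) fun z hz => (hfirst z hz).2.2 k)
    have h := congrArg (fun T : (Fin m → ℂ) →L[ℂ] ℂ => T (Pi.single k 1)) (h1.unique h2)
    simp only [sum_apply, add_apply,
      smul_apply, ContinuousLinearMap.proj_apply,
      ContinuousLinearMap.comp_apply, smul_eq_mul, neg_apply, ha',
      Finset.sum_add_distrib] at h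
    simp only [Pi.mul_apply, ← hAdef] at h
    have h3 : ∑ j, g j (Φ z) * (Pi.single k 1 : Fin m → ℂ) j = g k (Φ z) := by
      simp [Pi.single_apply]
    have h4 : ∑ j, z j * (fderiv ℂ (g j) (Φ z) w * fderiv ℂ a z (Pi.single k 1)) =
        S * fderiv ℂ a z (Pi.single k 1) := by
      rw [hS, Finset.sum_mul]
      exact Finset.sum_congr rfl fun j _ => by ring
    rw [h3, h4] at h
    linear_combination h
  have hgα := sum_mul_coeff_eq_zero_of_null L hw hN hα hnull (hmem z hz)
  have hga : ∑ k, g k (Φ z) * fderiv ℂ a z (Pi.single k 1) = 0 := by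
    apply mul_right_cancel₀ hA
    rw [zero_mul, Finset.sum_mul, ← neg_eq_zero, ← hgα, ← Finset.sum_neg_distrib]
    exact Finset.sum_congr rfl fun k _ => by linear_combination -g k (Φ z) * hak k
  have haa : ∑ k, fderiv ℂ a z (Pi.single k 1) * fderiv ℂ a z (Pi.single k 1) = 0 := by
    apply mul_right_cancel₀ (mul_ne_zero hA hA)
    rw [zero_mul, Finset.sum_mul, ← hnull _ (hmem z hz)]
    refine Finset.sum_congr rfl fun k _ => ?_
    linear_combination (fderiv ℂ a z (Pi.single k 1) * A - α k (Φ z)) * hak k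
  apply mul_right_cancel₀ hA
  rw [lapC, Finset.sum_mul, Finset.sum_congr rfl fun k _ => hsecond k, Finset.sum_neg_distrib,
    Finset.sum_add_distrib, ← Finset.mul_sum, ← Finset.mul_sum, hga, haa]
  simp

/-- A holomorphic map whose components are complex-harmonic with orthogonal gradients of equal
square norm is a complex-harmonic morphism. -/
theorem isCHMB_of_conformal {m : ℕ} {U : Set (Fin m → ℂ)} (hU : IsOpen U)
    {Φ : (Fin m → ℂ) → ℂ × ℂ} (hΦ : DifferentiableOn ℂ Φ U)
    (hlap₁ : ∀ z ∈ U, lapC (fun z => (Φ z).1) z = 0)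
    (hlap₂ : ∀ z ∈ U, lapC (fun z => (Φ z).2) z = 0)
    (hsq : ∀ z ∈ U, ∑ k, (gradB Φ z k).1 * (gradB Φ z k).1 =
      ∑ k, (gradB Φ z k).2 * (gradB Φ z k).2)
    (horth : ∀ z ∈ U, ∑ k, (gradB Φ z k).1 * (gradB Φ z k).2 = 0) :
    IsCHMB Φ U := by
  intro V hV f hf _
  have hW : IsOpen (U ∩ Φ ⁻¹' V) := hΦ.continuousOn.isOpen_inter_preimage hU hV
  refine ⟨hf.1.comp (hΦ.mono Set.inter_subset_left) fun z hz => hz.2, fun z hz => ?_⟩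
  have hΦ₁ : DifferentiableOn ℂ (fun z => (Φ z).1) U := hΦ.fst
  have hΦ₂ : DifferentiableOn ℂ (fun z => (Φ z).2) U := hΦ.snd
  have hΦ' : ∀ y ∈ U, ∀ v, fderiv ℂ Φ y v =
      (fderiv ℂ (fun z => (Φ z).1) y v, fderiv ℂ (fun z => (Φ z).2) y v) := by
    intro y hy v
    have h := (hΦ.differentiableAt (hU.mem_nhds hy)).hasFDerivAt
    rw [h.fst.fderiv, h.snd.fderiv]
    rfl
  have hsplit : ∀ (T : ℂ × ℂ →L[ℂ] ℂ) (x y : ℂ), T (x, y) = x * T (1, 0) + y * T (0, 1) := by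
    intro T x y
    rw [← smul_eq_mul, ← smul_eq_mul, ← map_smul, ← map_smul, ← map_add]
    simp
  have hchain : ∀ k, ∀ y ∈ U ∩ Φ ⁻¹' V, fderiv ℂ (f ∘ Φ) y (Pi.single k 1) =
      fderiv ℂ (fun z => (Φ z).1) y (Pi.single k 1) * fderiv ℂ f (Φ y) (1, 0) +
      fderiv ℂ (fun z => (Φ z).2) y (Pi.single k 1) * fderiv ℂ f (Φ y) (0, 1) := by
    intro k y hy
    rw [fderiv_comp y (hf.1.differentiableAt (hV.mem_nhds hy.2))
      (hΦ.differentiableAt (hU.mem_nhds hy.1)), ContinuousLinearMap.comp_apply, hΦ' y hy.1, hsplit]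
  have hzU := hU.mem_nhds hz.1
  have hzV := hV.mem_nhds hz.2
  have hdΦ := (hΦ.differentiableAt hzU).hasFDerivAt
  have hd₁ : ∀ v, HasFDerivAt (fun y => fderiv ℂ f (Φ y) v) _ z := fun v =>
    ((hf.1.fderiv_apply_complex hV v).differentiableAt hzV).hasFDerivAt.comp z hdΦ
  have hsecond : ∀ k, fderiv ℂ (fun y => fderiv ℂ (f ∘ Φ) y (Pi.single k 1)) z (Pi.single k 1) =
      fderiv ℂ (fun y => fderiv ℂ (fun z => (Φ z).1) y (Pi.single k 1)) z (Pi.single k 1) *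
        fderiv ℂ f (Φ z) (1, 0) +
      fderiv ℂ (fun y => fderiv ℂ (fun z => (Φ z).2) y (Pi.single k 1)) z (Pi.single k 1) *
        fderiv ℂ f (Φ z) (0, 1) +
      (gradB Φ z k).1 * (gradB Φ z k).1 *
        fderiv ℂ (fun w => fderiv ℂ f w (1, 0)) (Φ z) (1, 0) +
      (gradB Φ z k).2 * (gradB Φ z k).2 *
        fderiv ℂ (fun w => fderiv ℂ f w (0, 1)) (Φ z) (0, 1) +
      (gradB Φ z k).1 * (gradB Φ z k).2 *
        (fderiv ℂ (fun w => fderiv ℂ f w (1, 0)) (Φ z) (0, 1) +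
          fderiv ℂ (fun w => fderiv ℂ f w (0, 1)) (Φ z) (1, 0)) := by
    intro k
    have h₁ := ((hΦ₁.fderiv_apply_complex hU (Pi.single k 1)).differentiableAt hzU).hasFDerivAt
    have h₂ := ((hΦ₂.fderiv_apply_complex hU (Pi.single k 1)).differentiableAt hzU).hasFDerivAt
    have h := ((h₁.mul (hd₁ (1, 0))).add (h₂.mul (hd₁ (0, 1)))).congr_of_eventuallyEq
      (Filter.mem_of_superset (hW.mem_nhds hz) (hchain k))
    rw [h.fderiv]
    simp only [add_apply, smul_apply,
      ContinuousLinearMap.comp_apply, smul_eq_mul, hΦ' z hz.1]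
    rw [hsplit (fderiv ℂ (fun w => fderiv ℂ f w (1, 0)) (Φ z)),
      hsplit (fderiv ℂ (fun w => fderiv ℂ f w (0, 1)) (Φ z))]
    simp only [gradB]
    ring
  have hl₁ := hlap₁ z hz.1
  have hl₂ := hlap₂ z hz.1
  have hfl := hf.2 _ hz.2
  rw [lapC] at hl₁ hl₂
  rw [lapB] at hfl
  rw [lapC, Finset.sum_congr rfl fun k _ => hsecond k]
  simp only [Finset.sum_add_distrib, ← Finset.sum_mul]
  rw [hl₁, hl₂, horth z hz.1, ← hsq z hz.1]
  linear_combination (∑ k, (gradB Φ z k).1 * (gradB Φ z k).1) * hfl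

/-- The functional `q₁ + q₂ i₂ ↦ q₁ + c q₂`, an algebra homomorphism `𝔹 → ℂ` when `c² = -1`. -/
def bproj (c : ℂ) : ℂ × ℂ →L[ℂ] ℂ :=
  ContinuousLinearMap.fst ℂ ℂ ℂ + c • ContinuousLinearMap.snd ℂ ℂ ℂ

theorem bproj_apply (c : ℂ) (q : ℂ × ℂ) : bproj c q = q.1 + c * q.2 := rfl

theorem bproj_bmul {c : ℂ} (hc : c * c = -1) (q w : ℂ × ℂ) :
    bproj c (bmul q w) = bproj c q * bproj c w := by
  simp only [bproj_apply, bmul]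
  linear_combination -q.2 * w.2 * hc

theorem BicomplexHoloOn.hasFDerivAt_bproj {ψ : ℂ × ℂ → ℂ × ℂ} {N : Set (ℂ × ℂ)}
    (hψ : BicomplexHoloOn ψ N) (hN : IsOpen N) {c : ℂ} (hc : c * c = -1) {q : ℂ × ℂ}
    (hq : q ∈ N) :
    HasFDerivAt (fun q => bproj c (ψ q))
      (fderiv ℂ (fun q => bproj c (ψ q)) q (1, 0) • bproj c) q := by
  obtain ⟨h₁, h₂, hCR⟩ := hψ
  obtain ⟨e₁, e₂⟩ := hCR q hq
  have h : HasFDerivAt (fun q => bproj c (ψ q)) _ q :=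
    (h₁.differentiableAt (hN.mem_nhds hq)).hasFDerivAt.add
      ((h₂.differentiableAt (hN.mem_nhds hq)).hasFDerivAt.const_smul c)
  rw [h.fderiv]
  refine h.congr_fderiv ?_
  ext
  · simp [bproj_apply]
  · simp [bproj_apply, e₁, e₂]
    linear_combination -fderiv ℂ (fun q => (ψ q).2) q (1, 0) * hc

/-- if `ξ : N → 𝔹³` is bicomplex-holomorphic and null with `𝒩(ξ)` not
identically zero, then any C² solution `Φ : U → N` (`U ⊆ ℂ³` open) of
`⟨ξ(Φ(z)), z⟩_𝔹 = 1` is a complex-harmonic morphism of complex rank at least one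
everywhere, degenerate exactly where `𝒩(ξ(Φ(z))) = 0`. -/
theorem chm_from_null_xi (N : Set (ℂ × ℂ)) (hN : IsOpen N)
    (ξ : ℂ × ℂ → Fin 3 → ℂ × ℂ)
    (hholo : ∀ k : Fin 3, BicomplexHoloOn (fun q => ξ q k) N)
    (hnull : ∀ q ∈ N, ∑ k, bmul (ξ q k) (ξ q k) = 0)
    (hnz : ∃ q ∈ N, ∑ k, bN (ξ q k) ≠ 0)
    (U : Set (Fin 3 → ℂ)) (hU : IsOpen U)
    (Φ : (Fin 3 → ℂ) → ℂ × ℂ) (hC2 : ContDiffOn ℝ 2 Φ U)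
    (hmem : ∀ z ∈ U, Φ z ∈ N)
    (heq : ∀ z ∈ U, ∑ k, bmul (ξ (Φ z) k) ((z k : ℂ), (0 : ℂ)) = ((1 : ℂ), (0 : ℂ))) :
    DifferentiableOn ℂ Φ U ∧ IsCHMB Φ U ∧
    (∀ z ∈ U, fderiv ℂ Φ z ≠ 0) ∧
    (∀ z ∈ U, ((fderiv ℂ Φ z ≠ 0 ∧ ∑ k, bN (gradB Φ z k) = 0) ↔
      ∑ k, bN (ξ (Φ z) k) = 0)) := by
  have hII : Complex.I * Complex.I = -1 := Complex.I_mul_I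
  have hII' : -Complex.I * -Complex.I = -1 := by simp
  have hΦR : DifferentiableOn ℝ Φ U := hC2.differentiableOn (by norm_num)
  have hα : ∀ {c : ℂ}, c * c = -1 → ∀ k, ∀ q ∈ N, HasFDerivAt (fun q => bproj c (ξ q k))
      (fderiv ℂ (fun q => bproj c (ξ q k)) q (1, 0) • bproj c) q := fun hc k q hq =>
    (hholo k).hasFDerivAt_bproj hN hc hq
  have hαnull : ∀ {c : ℂ}, c * c = -1 → ∀ q ∈ N,
      ∑ k, bproj c (ξ q k) * bproj c (ξ q k) = 0 := fun hc q hq => by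
    simp only [← bproj_bmul hc, ← map_sum, hnull q hq, map_zero]
  have hαeq : ∀ {c : ℂ}, c * c = -1 → ∀ z ∈ U, ∑ k, bproj c (ξ (Φ z) k) * z k = 1 := by
    intro c hc z hz
    have h := congrArg (bproj c) (heq z hz)
    simpa [map_sum, bproj_bmul hc, bproj_apply c (_, 0)] using h
  have hfirst := fun {c : ℂ} (hc : c * c = -1) {z : Fin 3 → ℂ} (hz : z ∈ U) =>
    implicit_first_order (bproj c) (hα hc) hU hΦR hmem (hαeq hc) hz
  have hfst : ∀ q : ℂ × ℂ, q.1 = 2⁻¹ * (bproj Complex.I q + bproj (-Complex.I) q) := fun q => by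
    simp only [bproj_apply]
    ring
  have hsnd : ∀ q : ℂ × ℂ,
      q.2 = -(Complex.I / 2) * (bproj Complex.I q - bproj (-Complex.I) q) := fun q => by
    simp only [bproj_apply]
    linear_combination q.2 * hII
  have hΦ : DifferentiableOn ℂ Φ U := by
    intro z hz
    have ha := (hfirst hII hz).1
    have hb := (hfirst hII' hz).1
    have h := ((ha.add hb).const_mul 2⁻¹).prodMk ((ha.sub hb).const_mul (-(Complex.I / 2)))
    refine (h.congr_of_eventuallyEq (Filter.Eventually.of_forall fun y => ?_)).differentiableWithinAt
    exact Prod.ext (hfst _) (hsnd _)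
  have hgrad : ∀ c, ∀ z ∈ U, ∀ k, fderiv ℂ (fun z => bproj c (Φ z)) z (Pi.single k 1) =
      bproj c (gradB Φ z k) := by
    intro c z hz k
    have h := (hΦ.differentiableAt (hU.mem_nhds hz)).hasFDerivAt
    have h' : HasFDerivAt (fun z => bproj c (Φ z)) _ z := (bproj c).hasFDerivAt.comp z h
    rw [h'.fderiv, gradB, h.fst.fderiv, h.snd.fderiv]
    rfl
  have hlap : ∀ c, ∀ z ∈ U, lapC (fun z => bproj c (Φ z)) z =
      bproj c (lapC (fun z => (Φ z).1) z, lapC (fun z => (Φ z).2) z) := by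
    intro c z hz
    have h : ∀ k, fderiv ℂ (fun y => fderiv ℂ (fun z => bproj c (Φ z)) y (Pi.single k 1)) z
        (Pi.single k 1) =
        fderiv ℂ (fun y => fderiv ℂ (fun z => (Φ z).1) y (Pi.single k 1)) z (Pi.single k 1) +
        c * fderiv ℂ (fun y => fderiv ℂ (fun z => (Φ z).2) y (Pi.single k 1)) z
          (Pi.single k 1) := by
      intro k
      have hU' := hU.mem_nhds hz
      have h₁ := ((hΦ.fst.fderiv_apply_complex hU (Pi.single k 1)).differentiableAt hU').hasFDerivAt
      have h₂ := ((hΦ.snd.fderiv_apply_complex hU (Pi.single k 1)).differentiableAt hU').hasFDerivAt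
      have h := (h₁.add (h₂.const_mul c)).congr_of_eventuallyEq
        (Filter.mem_of_superset hU' fun y hy => hgrad c y hy k)
      rw [h.fderiv]
      rfl
    rw [bproj_apply]
    simp only [lapC, h, Finset.sum_add_distrib, Finset.mul_sum]
  have hlap0 : ∀ {c : ℂ}, c * c = -1 → ∀ z ∈ U,
      bproj c (lapC (fun z => (Φ z).1) z, lapC (fun z => (Φ z).2) z) = 0 := fun {c} hc z hz => by
    rw [← hlap c z hz]
    exact implicit_lapC_eq_zero (bproj c) (w := (1, 0)) (by simp [bproj_apply]) hN (hα hc)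
      (hαnull hc) hU hΦ hmem (hαeq hc) hz
  have hprop : ∀ {c : ℂ}, c * c = -1 → ∀ z ∈ U, ∃ A : ℂ, A ≠ 0 ∧
      ∀ k, bproj c (gradB Φ z k) * A = -bproj c (ξ (Φ z) k) := fun {c} hc z hz => by
    obtain ⟨-, hA, hk⟩ := hfirst hc hz
    exact ⟨_, hA, fun k => by rw [← hgrad c z hz k, hk k]⟩
  have hgnull : ∀ {c : ℂ}, c * c = -1 → ∀ z ∈ U,
      ∑ k, (gradB Φ z k).1 * (gradB Φ z k).1 - ∑ k, (gradB Φ z k).2 * (gradB Φ z k).2 +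
        2 * c * ∑ k, (gradB Φ z k).1 * (gradB Φ z k).2 = 0 := by
    intro c hc z hz
    obtain ⟨A, hA, hk⟩ := hprop hc z hz
    apply mul_right_cancel₀ (mul_ne_zero hA hA)
    rw [zero_mul, ← hαnull hc _ (hmem z hz), ← Finset.sum_sub_distrib, Finset.mul_sum,
      ← Finset.sum_add_distrib, Finset.sum_mul]
    refine Finset.sum_congr rfl fun k _ => ?_
    have h := hk k
    rw [bproj_apply c (gradB Φ z k)] at h
    linear_combination ((gradB Φ z k).1 * A + c * (gradB Φ z k).2 * A - bproj c (ξ (Φ z) k)) * h -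
      (gradB Φ z k).2 * (gradB Φ z k).2 * (A * A) * hc
  have hne : ∀ z ∈ U, fderiv ℂ Φ z ≠ 0 := by
    intro z hz h0
    obtain ⟨A, -, hk⟩ := hprop hII z hz
    have h := (hΦ.differentiableAt (hU.mem_nhds hz)).hasFDerivAt
    have hg : ∀ k, gradB Φ z k = 0 := fun k => by
      rw [gradB, h.fst.fderiv, h.snd.fderiv, h0]
      rfl
    have hξ : ∀ k, bproj Complex.I (ξ (Φ z) k) = 0 := fun k => by
      simpa [hg k] using (hk k).symm
    simpa [hξ] using hαeq hII z hz
  have hbN : ∀ q, bN q = bproj Complex.I q * bproj (-Complex.I) q := fun q => by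
    simp only [bproj_apply, bN]
    linear_combination q.2 * q.2 * hII
  refine ⟨hΦ, isCHMB_of_conformal hU hΦ (fun z hz => ?_) (fun z hz => ?_) (fun z hz => ?_)
    (fun z hz => ?_), hne, fun z hz => ?_⟩
  · simpa [hlap0 hII z hz, hlap0 hII' z hz] using
      hfst (lapC (fun z => (Φ z).1) z, lapC (fun z => (Φ z).2) z)
  · simpa [hlap0 hII z hz, hlap0 hII' z hz] using
      hsnd (lapC (fun z => (Φ z).1) z, lapC (fun z => (Φ z).2) z)
  · linear_combination 2⁻¹ * (hgnull hII z hz + hgnull hII' z hz)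
  · linear_combination -(Complex.I / 4) * (hgnull hII z hz - hgnull hII' z hz) +
      (∑ k, (gradB Φ z k).1 * (gradB Φ z k).2) * hII
  · obtain ⟨A, hA, hAk⟩ := hprop hII z hz
    obtain ⟨B, hB, hBk⟩ := hprop hII' z hz
    have h : (∑ k, bN (gradB Φ z k)) * (A * B) = ∑ k, bN (ξ (Φ z) k) := by
      rw [Finset.sum_mul]
      refine Finset.sum_congr rfl fun k _ => ?_
      rw [hbN, hbN, mul_mul_mul_comm, hAk, hBk, neg_mul_neg]
    rw [← h, mul_eq_zero, or_iff_left (mul_ne_zero hA hB), and_iff_right (hne z hz)]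
end
end

section
/- Let ξ = u + v·i₂ ∈ 𝔹³ (u, v ∈ ℂ³) satisfy ξ² = 0 and ξ ∉ 𝒩fat. Then the following are equivalent: (i) 𝒩(ξ) = 0; (ii) there exist w ∈ ℂ³ ∖ {0} with w² = ⟨w,w⟩_ℂ = 0 and λ ∈ 𝔹 with 𝒩(λ) ≠ 0 such that ξ = λ·w (componentwise, with w_k ∈ ℂ ⊆ 𝔹). Moreover, when (ii) holds the projective class [w] ∈ ℙ²(ℂ) is unique: if ξ = λ·w = λ′·w′ with both pairs as in (ii), then w′ = c·w for some c ∈ ℂ ∖ {0}. -/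
noncomputable section

/-- Two mutually orthogonal isotropic vectors of `ℂ³` are proportional. -/
theorem mul_eq_mul_of_isotropic {u v : Fin 3 → ℂ} (hu : ∑ k, u k ^ 2 = 0)
    (hv : ∑ k, v k ^ 2 = 0) (huv : ∑ k, u k * v k = 0) (i j : Fin 3) :
    u i * v j = u j * v i := by
  simp only [Fin.sum_univ_three] at hu hv huv
  have h01 : u 0 * v 1 - u 1 * v 0 = 0 := by
    apply pow_eq_zero_iff (two_ne_zero) |>.mp
    linear_combination (v 0 ^ 2 + v 1 ^ 2) * hu - u 2 ^ 2 * hv -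
      (u 0 * v 0 + u 1 * v 1 - u 2 * v 2) * huv
  have h02 : u 0 * v 2 - u 2 * v 0 = 0 := by
    apply pow_eq_zero_iff (two_ne_zero) |>.mp
    linear_combination (v 0 ^ 2 + v 2 ^ 2) * hu - u 1 ^ 2 * hv -
      (u 0 * v 0 + u 2 * v 2 - u 1 * v 1) * huv
  have h12 : u 1 * v 2 - u 2 * v 1 = 0 := by
    apply pow_eq_zero_iff (two_ne_zero) |>.mp
    linear_combination (v 1 ^ 2 + v 2 ^ 2) * hu - u 0 ^ 2 * hv -
      (u 1 * v 1 + u 2 * v 2 - u 0 * v 0) * huv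
  fin_cases i <;> fin_cases j <;> grind

theorem bmul_ofComplex (q : ℂ × ℂ) (z : ℂ) : bmul q (z, 0) = (q.1 * z, q.2 * z) := by
  simp [bmul]

theorem bN_bmul_ofComplex (q : ℂ × ℂ) (z : ℂ) : bN (bmul q (z, 0)) = bN q * z ^ 2 := by
  simp only [bmul_ofComplex, bN]
  ring

/-- If a nonzero multiple of `w'` is a multiple of `w`, then `w'` is a nonzero multiple of `w`. -/
theorem exists_smul_eq_of_mul_eq_mul {ι : Type*} {w w' : ι → ℂ} {a b : ℂ} (hw' : w' ≠ 0)
    (hb : b ≠ 0) (h : ∀ k, a * w k = b * w' k) : ∃ c : ℂ, c ≠ 0 ∧ w' = c • w := by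
  have key : w' = (a / b) • w := by
    ext k
    simp only [Pi.smul_apply, smul_eq_mul]
    field_simp
    linear_combination -h k
  refine ⟨a / b, fun h0 => hw' ?_, key⟩
  rw [key, h0, zero_smul]

/-- for a null bicomplex vector `ξ ∈ 𝔹³` not in the fattened origin,
`𝒩(ξ) = 0` iff `ξ = λ·w` for some nonzero null `w ∈ ℂ³` and `λ ∈ 𝔹` with
`𝒩(λ) ≠ 0`; moreover the projective class of such `w` is unique. -/
theorem complex_representative (ξ : Fin 3 → ℂ × ℂ)
    (hnull : ∑ k, bmul (ξ k) (ξ k) = 0)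
    (hfat : ¬ ∀ k, bN (ξ k) = 0) :
    ((∑ k, bN (ξ k)) = 0 ↔
      ∃ w : Fin 3 → ℂ, w ≠ 0 ∧ (∑ k, w k ^ 2) = 0 ∧
        ∃ lam : ℂ × ℂ, bN lam ≠ 0 ∧ ∀ k, ξ k = bmul lam ((w k), (0 : ℂ))) ∧
    (∀ (w w' : Fin 3 → ℂ) (lam lam' : ℂ × ℂ),
      w ≠ 0 → (∑ k, w k ^ 2) = 0 → bN lam ≠ 0 → (∀ k, ξ k = bmul lam ((w k), (0 : ℂ))) →
      w' ≠ 0 → (∑ k, w' k ^ 2) = 0 → bN lam' ≠ 0 →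
        (∀ k, ξ k = bmul lam' ((w' k), (0 : ℂ))) →
      ∃ c : ℂ, c ≠ 0 ∧ w' = c • w) := by
  refine ⟨⟨fun hN => ?_, ?_⟩, ?_⟩
  · have h1 := congrArg Prod.fst hnull
    have h2 := congrArg Prod.snd hnull
    simp only [Prod.fst_add, Prod.snd_add, bmul, bN, Fin.sum_univ_three, Prod.fst_zero,
      Prod.snd_zero] at h1 h2 hN
    have hu : ∑ k, (ξ k).1 ^ 2 = 0 := by
      rw [Fin.sum_univ_three]
      linear_combination (h1 + hN) / 2
    have hv : ∑ k, (ξ k).2 ^ 2 = 0 := by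
      rw [Fin.sum_univ_three]
      linear_combination (hN - h1) / 2
    have huv : ∑ k, (ξ k).1 * (ξ k).2 = 0 := by
      rw [Fin.sum_univ_three]
      linear_combination h2 / 2
    have hprop := mul_eq_mul_of_isotropic hu hv huv
    suffices h : ∃ w : Fin 3 → ℂ, w ≠ 0 ∧ (∑ k, w k ^ 2) = 0 ∧
        ∃ lam : ℂ × ℂ, ∀ k, ξ k = bmul lam (w k, (0 : ℂ)) by
      obtain ⟨w, hw, hw2, lam, hlam⟩ := h
      refine ⟨w, hw, hw2, lam, fun h0 => hfat fun k => ?_, hlam⟩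
      rw [hlam k, bN_bmul_ofComplex, h0, zero_mul]
    by_cases hu0 : ∀ k, (ξ k).1 = 0
    · refine ⟨fun k => (ξ k).2, fun h0 => hfat fun k => ?_, hv, (0, 1), fun k => ?_⟩
      · have hk : (ξ k).2 = 0 := congrFun h0 k
        simp [bN, hu0 k, hk]
      · simp [bmul_ofComplex, Prod.ext_iff, hu0 k]
    · push Not at hu0
      obtain ⟨i, hi⟩ := hu0
      refine ⟨fun k => (ξ k).1, fun h0 => hi (congrFun h0 i), hu, (1, (ξ i).2 / (ξ i).1),
        fun k => ?_⟩
      rw [bmul_ofComplex]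
      ext1
      · simp
      · dsimp only
        field_simp
        linear_combination hprop i k
  · rintro ⟨w, -, hw2, lam, -, hlam⟩
    simp_rw [hlam, bN_bmul_ofComplex, ← Finset.mul_sum, hw2, mul_zero]
  · intro w w' lam lam' _ _ _ hlam hw' _ hN' hlam'
    have h (k) : (lam.1 * w k, lam.2 * w k) = (lam'.1 * w' k, lam'.2 * w' k) := by
      rw [← bmul_ofComplex, ← bmul_ofComplex, ← hlam, ← hlam']
    by_cases h1 : lam'.1 = 0
    · have h2 : lam'.2 ≠ 0 := fun h2 => hN' (by simp [bN, h1, h2])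
      exact exists_smul_eq_of_mul_eq_mul hw' h2 fun k => congrArg Prod.snd (h k)
    · exact exists_smul_eq_of_mul_eq_mul hw' h1 fun k => congrArg Prod.fst (h k)
end
end

section
/- Let a := (1/2, −i/2) ∈ 𝔹 and b := (1/2, i/2) ∈ 𝔹 (so a = (1−j)/2, b = (1+j)/2 with j := i₁i₂). Then the map ([η], [ρ]) ↦ [η·a + ρ·b] (where η·a + ρ·b ∈ 𝔹³ has k-th component η_k·a + ρ_k·b, with η_k, ρ_k ∈ ℂ ⊆ 𝔹) is well-defined and is a bijection from Q¹_ℂ × Q¹_ℂ onto the bicomplex quadric Q¹_𝔹; in particular Q¹_𝔹 is in natural bijection with ℂP¹ × ℂP¹. -/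
noncomputable section

/-- `CQ¹_𝔹`: null bicomplex vectors in `𝔹³` avoiding the fattened origin. -/
def CQset : Set (Fin 3 → ℂ × ℂ) :=
  {ξ | (¬ ∀ k, bN (ξ k) = 0) ∧ ∑ k, bmul (ξ k) (ξ k) = 0}

/-- The relation `ξ ∼ ξ'` iff `ξ' = λ·ξ` for some `λ ∈ 𝔹`. -/
def brel (ξ ξ' : CQset) : Prop :=
  ∃ lam : ℂ × ℂ, ∀ k, (ξ' : Fin 3 → ℂ × ℂ) k = bmul lam ((ξ : Fin 3 → ℂ × ℂ) k)

/-- The bicomplex quadric `Q¹_𝔹`. -/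
def Q1B := Quot brel

/-- Nonzero null vectors in `ℂ³`. -/
def nullC : Set (Fin 3 → ℂ) := {w | w ≠ 0 ∧ ∑ k, w k ^ 2 = 0}

/-- Projective equivalence of null vectors. -/
def crel (w w' : nullC) : Prop :=
  ∃ c : ℂ, c ≠ 0 ∧ (w' : Fin 3 → ℂ) = c • (w : Fin 3 → ℂ)

/-- The complex quadric curve `Q¹_ℂ ⊆ ℙ²(ℂ)`. -/
def Q1C := Quot crel

/-- The idempotent `a = (1 − j)/2 ∈ 𝔹`. -/
def Ba : ℂ × ℂ := ((1 / 2 : ℂ), (-(Complex.I) / 2 : ℂ))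

/-- The idempotent `b = (1 + j)/2 ∈ 𝔹`. -/
def Bb : ℂ × ℂ := ((1 / 2 : ℂ), (Complex.I / 2 : ℂ))

/-- The component `η ∈ ℂ` of the bicomplex number `η·a + ρ·b`. -/
def aComponent (q : ℂ × ℂ) : ℂ := q.1 + Complex.I * q.2

/-- The component `ρ ∈ ℂ` of the bicomplex number `η·a + ρ·b`. -/
def bComponent (q : ℂ × ℂ) : ℂ := q.1 - Complex.I * q.2

/-- The bicomplex number `x·a + y·b`. -/
def ofComponents (x y : ℂ) : ℂ × ℂ := bmul (x, 0) Ba + bmul (y, 0) Bb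

lemma aComponent_ofComponents (x y : ℂ) : aComponent (ofComponents x y) = x := by
  simp only [aComponent, ofComponents, bmul, Ba, Bb, Prod.fst_add, Prod.snd_add]
  linear_combination (y - x) / 2 * Complex.I_sq

lemma bComponent_ofComponents (x y : ℂ) : bComponent (ofComponents x y) = y := by
  simp only [bComponent, ofComponents, bmul, Ba, Bb, Prod.fst_add, Prod.snd_add]
  linear_combination (x - y) / 2 * Complex.I_sq

lemma ofComponents_aComponent_bComponent (q : ℂ × ℂ) :
    ofComponents (aComponent q) (bComponent q) = q := by
  simp only [aComponent, bComponent, ofComponents, bmul, Ba, Bb]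
  ext
  · simp only [Prod.fst_add]
    ring
  · simp only [Prod.snd_add]
    linear_combination -q.2 * Complex.I_sq

lemma aComponent_bmul (q w : ℂ × ℂ) :
    aComponent (bmul q w) = aComponent q * aComponent w := by
  simp only [aComponent, bmul]
  linear_combination -(q.2 * w.2) * Complex.I_sq

lemma bComponent_bmul (q w : ℂ × ℂ) :
    bComponent (bmul q w) = bComponent q * bComponent w := by
  simp only [bComponent, bmul]
  linear_combination -(q.2 * w.2) * Complex.I_sq

lemma bN_eq_mul (q : ℂ × ℂ) : bN q = aComponent q * bComponent q := by
  simp only [aComponent, bComponent, bN]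
  linear_combination q.2 ^ 2 * Complex.I_sq

lemma ext_components {q w : ℂ × ℂ} (ha : aComponent q = aComponent w)
    (hb : bComponent q = bComponent w) : q = w := by
  rw [← ofComponents_aComponent_bComponent q, ha, hb, ofComponents_aComponent_bComponent]

lemma aComponent_sum (f : Fin 3 → ℂ × ℂ) : aComponent (∑ k, f k) = ∑ k, aComponent (f k) := by
  simp only [aComponent, Fin.sum_univ_three, Prod.fst_add, Prod.snd_add]
  ring

lemma bComponent_sum (f : Fin 3 → ℂ × ℂ) : bComponent (∑ k, f k) = ∑ k, bComponent (f k) := by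
  simp only [bComponent, Fin.sum_univ_three, Prod.fst_add, Prod.snd_add]
  ring

/-- Each null vector has at most one vanishing coordinate, so two of them have a common
nonvanishing coordinate. -/
lemma exists_mul_ne_zero_of_mem_nullC {η ρ : Fin 3 → ℂ} (hη : η ∈ nullC) (hρ : ρ ∈ nullC) :
    ∃ k, η k * ρ k ≠ 0 := by
  obtain ⟨hη0, hη⟩ := hη
  obtain ⟨hρ0, hρ⟩ := hρ
  by_contra! h
  have h0 := h 0
  have h1 := h 1
  have h2 := h 2
  rw [Fin.sum_univ_three] at hη hρ
  have key : ∀ w : Fin 3 → ℂ, w 0 = 0 → w 1 = 0 → w 2 = 0 → w = 0 := by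
    intro w w0 w1 w2
    ext k
    fin_cases k <;> assumption
  simp only [mul_eq_zero] at h0 h1 h2
  rcases h0 with h0 | h0 <;> rcases h1 with h1 | h1 <;> rcases h2 with h2 | h2 <;>
    simp [h0, h1, h2] at hη hρ <;> first
    | exact hη0 (key _ ‹_› ‹_› ‹_›)
    | exact hρ0 (key _ ‹_› ‹_› ‹_›)

lemma mem_CQset_iff {ξ : Fin 3 → ℂ × ℂ} :
    ξ ∈ CQset ↔ (fun k => aComponent (ξ k)) ∈ nullC ∧ (fun k => bComponent (ξ k)) ∈ nullC := by
  constructor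
  · rintro ⟨hN, hsum⟩
    refine ⟨⟨fun h => hN fun k => ?_, ?_⟩, ⟨fun h => hN fun k => ?_, ?_⟩⟩
    · rw [bN_eq_mul, show aComponent (ξ k) = 0 from congrFun h k, zero_mul]
    · have := congrArg aComponent hsum
      simp only [aComponent_sum, aComponent_bmul, ← sq] at this
      simpa [aComponent] using this
    · rw [bN_eq_mul, show bComponent (ξ k) = 0 from congrFun h k, mul_zero]
    · have := congrArg bComponent hsum
      simp only [bComponent_sum, bComponent_bmul, ← sq] at this
      simpa [bComponent] using this
  · rintro ⟨ha, hb⟩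
    refine ⟨fun h => ?_, ext_components ?_ ?_⟩
    · obtain ⟨k, hk⟩ := exists_mul_ne_zero_of_mem_nullC ha hb
      exact hk (by rw [← bN_eq_mul, h k])
    · rw [aComponent_sum]
      simp only [aComponent_bmul, ← sq]
      rw [ha.2]
      simp [aComponent]
    · rw [bComponent_sum]
      simp only [bComponent_bmul, ← sq]
      rw [hb.2]
      simp [bComponent]

/-- The null bicomplex vector `η·a + ρ·b`. -/
def combineNull (η ρ : nullC) : CQset :=
  ⟨fun k => ofComponents (η.1 k) (ρ.1 k), mem_CQset_iff.2 (by
    simp only [aComponent_ofComponents, bComponent_ofComponents]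
    exact ⟨η.2, ρ.2⟩)⟩

lemma brel_combineNull {η η' ρ ρ' : nullC} {c d : ℂ} (hc : η'.1 = c • η.1) (hd : ρ'.1 = d • ρ.1) :
    brel (combineNull η ρ) (combineNull η' ρ') := by
  refine ⟨ofComponents c d, fun k => ext_components ?_ ?_⟩
  · simp [combineNull, aComponent_bmul, aComponent_ofComponents, hc]
  · simp [combineNull, bComponent_bmul, bComponent_ofComponents, hd]

/-- The `a`-component of a null bicomplex vector. -/
def aPart (ξ : CQset) : nullC := ⟨fun k => aComponent (ξ.1 k), (mem_CQset_iff.1 ξ.2).1⟩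

/-- The `b`-component of a null bicomplex vector. -/
def bPart (ξ : CQset) : nullC := ⟨fun k => bComponent (ξ.1 k), (mem_CQset_iff.1 ξ.2).2⟩

lemma crel_of_eq_smul {w w' : nullC} {c : ℂ} (h : w'.1 = c • w.1) : crel w w' :=
  ⟨c, fun hc => w'.2.1 (by rw [h, hc, zero_smul]), h⟩

lemma crel_aPart {ξ ξ' : CQset} (h : brel ξ ξ') : crel (aPart ξ) (aPart ξ') := by
  obtain ⟨lam, h⟩ := h
  refine crel_of_eq_smul (c := aComponent lam) (funext fun k => ?_)
  simp [aPart, h, aComponent_bmul]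

lemma crel_bPart {ξ ξ' : CQset} (h : brel ξ ξ') : crel (bPart ξ) (bPart ξ') := by
  obtain ⟨lam, h⟩ := h
  refine crel_of_eq_smul (c := bComponent lam) (funext fun k => ?_)
  simp [bPart, h, bComponent_bmul]

/-- The bijection `([η], [ρ]) ↦ [η·a + ρ·b]`. -/
def prodEquivQ1B : Q1C × Q1C ≃ Q1B where
  toFun p := Quot.map₂ combineNull
    (fun _ _ _ ⟨_, _, hd⟩ => brel_combineNull (one_smul ℂ _).symm hd)
    (fun _ _ _ ⟨_, _, hc⟩ => brel_combineNull hc (one_smul ℂ _).symm) p.1 p.2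
  invFun q := (Quot.map aPart (fun _ _ => crel_aPart) q, Quot.map bPart (fun _ _ => crel_bPart) q)
  left_inv := by
    rintro ⟨⟨η⟩, ⟨ρ⟩⟩
    refine Prod.ext (congrArg (Quot.mk crel) (Subtype.ext (funext fun k => ?_)))
      (congrArg (Quot.mk crel) (Subtype.ext (funext fun k => ?_)))
    · exact aComponent_ofComponents _ _
    · exact bComponent_ofComponents _ _
  right_inv := by
    rintro ⟨ξ⟩
    exact congrArg (Quot.mk brel)
      (Subtype.ext (funext fun k => ofComponents_aComponent_bComponent _))

lemma equivalence_crel : Equivalence crel where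
  refl w := ⟨1, one_ne_zero, (one_smul ℂ _).symm⟩
  symm := by
    rintro w w' ⟨c, hc, h⟩
    exact ⟨c⁻¹, inv_ne_zero hc, by rw [h, inv_smul_smul₀ hc]⟩
  trans := by
    rintro w w' w'' ⟨c, hc, h⟩ ⟨d, hd, h'⟩
    exact ⟨d * c, mul_ne_zero hd hc, by rw [h', h, mul_smul]⟩

lemma crel_of_mk_eq {w w' : nullC} (h : Quot.mk crel w = Quot.mk crel w') : crel w w' :=
  equivalence_crel.eqvGen_iff.1 (Quot.eqvGen_exact h)

/-- The rational parametrization `(s, t) ↦ (s² - t², i(s² + t²), 2st)` of the null cone in `ℂ³`. -/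
def conicVec (v : Fin 2 → ℂ) : Fin 3 → ℂ :=
  ![v 0 ^ 2 - v 1 ^ 2, Complex.I * (v 0 ^ 2 + v 1 ^ 2), 2 * v 0 * v 1]

lemma conicVec_mem_nullC {v : Fin 2 → ℂ} (hv : v ≠ 0) : conicVec v ∈ nullC := by
  constructor
  · intro h
    have h0 : v 0 ^ 2 - v 1 ^ 2 = 0 := congrFun h 0
    have h1 : Complex.I * (v 0 ^ 2 + v 1 ^ 2) = 0 := congrFun h 1
    have h1 := (mul_eq_zero.1 h1).resolve_left Complex.I_ne_zero
    have hs : v 0 = 0 := pow_eq_zero_iff two_ne_zero |>.1 (by linear_combination (h0 + h1) / 2)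
    have ht : v 1 = 0 := pow_eq_zero_iff two_ne_zero |>.1 (by linear_combination (h1 - h0) / 2)
    exact hv (funext fun k => by fin_cases k <;> assumption)
  · simp only [conicVec, Fin.sum_univ_three, Matrix.cons_val]
    linear_combination (v 0 ^ 2 + v 1 ^ 2) ^ 2 * Complex.I_sq

lemma conicVec_smul (c : ℂ) (v : Fin 2 → ℂ) : conicVec (c • v) = c ^ 2 • conicVec v := by
  ext k
  fin_cases k <;> simp [conicVec] <;> ring

/-- The parametrization `ℂP¹ → Q¹_ℂ`. -/
def conicMap : Projectivization ℂ (Fin 2 → ℂ) → Q1C :=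
  Projectivization.lift (fun v => Quot.mk crel ⟨conicVec v.1, conicVec_mem_nullC v.2⟩) (by
    intro v w t h
    refine (Quot.sound (crel_of_eq_smul (c := t ^ 2) ?_)).symm
    simp only [h, conicVec_smul])

lemma conicMap_mk (v : Fin 2 → ℂ) (hv : v ≠ 0) :
    conicMap (Projectivization.mk ℂ v hv) = Quot.mk crel ⟨conicVec v, conicVec_mem_nullC hv⟩ :=
  rfl

lemma exists_smul_eq_of_mul_eq_mul_s13 {v w : Fin 2 → ℂ} (hw : w ≠ 0)
    (h : v 0 * w 1 = v 1 * w 0) : ∃ c : ℂ, c • w = v := by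
  by_cases h0 : w 0 = 0
  · have h1 : w 1 ≠ 0 := fun h1 => hw (funext fun k => by fin_cases k <;> assumption)
    have hv : v 0 = 0 := by simpa [h0, h1] using h
    refine ⟨v 1 / w 1, funext fun k => ?_⟩
    fin_cases k
    · simp [h0, hv]
    · simp [h1]
  · refine ⟨v 0 / w 0, funext fun k => ?_⟩
    fin_cases k
    · simp [h0]
    · simp only [Fin.mk_one, Pi.smul_apply, smul_eq_mul]
      field_simp
      exact h.trans (mul_comm _ _)

lemma conicMap_injective : Function.Injective conicMap := by
  intro p q
  induction p using Projectivization.ind with | h v hv => ?_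
  induction q using Projectivization.ind with | h w hw => ?_
  intro h
  rw [conicMap_mk, conicMap_mk] at h
  obtain ⟨c, -, hc⟩ := crel_of_mk_eq h.symm
  have h0 : v 0 ^ 2 - v 1 ^ 2 = c * (w 0 ^ 2 - w 1 ^ 2) := congrFun hc 0
  have h1 : Complex.I * (v 0 ^ 2 + v 1 ^ 2) = c * (Complex.I * (w 0 ^ 2 + w 1 ^ 2)) := congrFun hc 1
  have h2 : 2 * v 0 * v 1 = c * (2 * w 0 * w 1) := congrFun hc 2
  have h1 : v 0 ^ 2 + v 1 ^ 2 = c * (w 0 ^ 2 + w 1 ^ 2) :=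
    mul_left_cancel₀ Complex.I_ne_zero (by linear_combination h1)
  have hdet : (v 0 * w 1 - v 1 * w 0) ^ 2 = 0 := by
    linear_combination (h0 + h1) / 2 * w 1 ^ 2 + (h1 - h0) / 2 * w 0 ^ 2 - h2 * w 0 * w 1
  rw [Projectivization.mk_eq_mk_iff']
  exact exists_smul_eq_of_mul_eq_mul_s13 hw (sub_eq_zero.1 (pow_eq_zero_iff two_ne_zero |>.1 hdet))

lemma conicMap_surjective : Function.Surjective conicMap := by
  rintro ⟨w, hw⟩
  have hsum := hw.2
  rw [Fin.sum_univ_three] at hsum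
  by_cases hu : w 0 - Complex.I * w 1 = 0
  · have hw2 : w 2 = 0 := pow_eq_zero_iff two_ne_zero |>.1 (by
      linear_combination hsum - (w 0 + Complex.I * w 1) * hu - w 1 ^ 2 * Complex.I_sq)
    refine ⟨Projectivization.mk ℂ ![0, 1] (fun h => one_ne_zero (congrFun h 1)), ?_⟩
    rw [conicMap_mk]
    refine Quot.sound (crel_of_eq_smul (c := -w 0) (funext fun k => ?_))
    fin_cases k
    · simp [conicVec]
    · simp only [conicVec, Fin.mk_one, Pi.smul_apply, smul_eq_mul, Matrix.cons_val]
      linear_combination Complex.I * hu + w 1 * Complex.I_sq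
    · simp [conicVec, hw2]
  · refine ⟨Projectivization.mk ℂ ![w 0 - Complex.I * w 1, w 2] (fun h => hu (congrFun h 0)), ?_⟩
    rw [conicMap_mk]
    refine (Quot.sound (crel_of_eq_smul (c := 2 * (w 0 - Complex.I * w 1))
      (funext fun k => ?_))).symm
    fin_cases k
    · simp only [conicVec, Fin.zero_eta, Pi.smul_apply, smul_eq_mul, Matrix.cons_val]
      linear_combination -hsum + w 1 ^ 2 * Complex.I_sq
    · simp only [conicVec, Fin.mk_one, Pi.smul_apply, smul_eq_mul, Matrix.cons_val]
      linear_combination Complex.I * hsum + (Complex.I * w 1 ^ 2 - 2 * w 0 * w 1) * Complex.I_sq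
    · simp only [conicVec, Fin.reduceFinMk, Pi.smul_apply, smul_eq_mul, Matrix.cons_val]

/-- The complex quadric curve is a projective line. -/
def projectivizationEquivQ1C : Projectivization ℂ (Fin 2 → ℂ) ≃ Q1C :=
  Equiv.ofBijective conicMap ⟨conicMap_injective, conicMap_surjective⟩

/-- `([η],[ρ]) ↦ [η·a + ρ·b]` is a well-defined bijection
`Q¹_ℂ × Q¹_ℂ → Q¹_𝔹`; in particular `Q¹_𝔹` is in bijection with `ℂP¹ × ℂP¹`. -/
theorem Q1B_product_structure :
    (∃ F : Q1C × Q1C → Q1B, Function.Bijective F ∧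
      ∀ (η ρ : Fin 3 → ℂ) (hη : η ∈ nullC) (hρ : ρ ∈ nullC)
        (hm : (fun k => bmul ((η k), (0 : ℂ)) Ba + bmul ((ρ k), (0 : ℂ)) Bb) ∈ CQset),
        F (Quot.mk crel ⟨η, hη⟩, Quot.mk crel ⟨ρ, hρ⟩) =
          Quot.mk brel ⟨fun k => bmul ((η k), (0 : ℂ)) Ba + bmul ((ρ k), (0 : ℂ)) Bb, hm⟩) ∧
    Nonempty (Q1B ≃ Projectivization ℂ (Fin 2 → ℂ) × Projectivization ℂ (Fin 2 → ℂ)) := by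
  refine ⟨⟨prodEquivQ1B, prodEquivQ1B.bijective, fun _ _ _ _ _ => rfl⟩, ⟨?_⟩⟩
  exact prodEquivQ1B.symm.trans
    (projectivizationEquivQ1C.symm.prodCongr projectivizationEquivQ1C.symm)
end
end
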